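/- arXiv:2010.06031 — 2 statements merged into one kernel-verified Lean document; each statement's English description precedes it below -/
import Mathlib

section
/- Let (G,S) be a set-equipped graph and let (G',S') be an out-splitting or in-splitting of (G,S) at a vertex v. Then X(G',S') has the same topological entropy as X(G,S); X(G',S') is mixing if X(G,S) is; X(G',S') has the weak specification property (respectively, the specification property) if and only if X(G,S) does; and X(G',S') is a subshift of finite type (respectively, sofic) if and only if X(G,S) is. -/
open Filter Topology

/-- The shift map on bi-infinite sequences over the alphabet `A`. -/
def shiftMap {A : Type*} (x : ℤ → A) : ℤ → A := fun i => x (i + 1)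

/-- A finite word `w` appears (as a consecutive subsequence) in the bi-infinite
sequence `x`. -/
def Appears {A : Type*} (w : List A) (x : ℤ → A) : Prop :=
  ∃ k : ℤ, ∀ i : Fin w.length, x (k + (i : ℕ)) = w.get i

/-- `w` belongs to the language of `X`: it appears in some point of `X`. -/
def InLanguage {A : Type*} (X : Set (ℤ → A)) (w : List A) : Prop :=
  ∃ x ∈ X, Appears w x

/-- `X` has topological entropy `h`, i.e. `(1/n) · log |B_n(X)| → h`. -/
def HasEntropy {A : Type*} (X : Set (ℤ → A)) (h : ℝ) : Prop :=
  Filter.Tendsto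
    (fun n : ℕ => Real.log ({w : List A | w.length = n ∧ InLanguage X w}.ncard) / n)
    Filter.atTop (nhds h)

/-- The set of bi-infinite concatenations `⋯ u₋₁^{n₋₁} u₀^{n₀} u₁^{n₁} ⋯` with
`uᵢ ∈ V`, `nᵢ ∈ S uᵢ` and `(uᵢ, uᵢ₊₁)` an edge of the graph.  The `S`-graph shift
`X(G,S)` is the closure of this set. -/
def SGraphCore {V : Type*} (Adj : V → V → Prop) (S : V → Set ℕ) : Set (ℤ → V) :=
  {x | ∃ (a : ℤ → V) (t : ℤ → ℤ), StrictMono t ∧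
    (∀ i : ℤ, (t (i + 1) - t i).toNat ∈ S (a i)) ∧
    (∀ i : ℤ, Adj (a i) (a (i + 1))) ∧
    (∀ i k : ℤ, t i ≤ k → k < t (i + 1) → x k = a i) ∧
    (∀ m : ℤ, ∃ i : ℤ, t i ≤ m ∧ m < t (i + 1))}

/-- `X` is mixing. -/
def IsMixing {A : Type*} (X : Set (ℤ → A)) : Prop :=
  ∀ α β : List A, InLanguage X α → InLanguage X β →
    ∃ N : ℕ, ∀ n ≥ N, ∃ γ : List A, γ.length = n ∧ InLanguage X (α ++ γ ++ β)

/-- `X` has the specification property. -/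
def HasSpecification {A : Type*} (X : Set (ℤ → A)) : Prop :=
  ∃ N : ℕ, ∀ α β : List A, InLanguage X α → InLanguage X β →
    ∃ γ : List A, γ.length = N ∧ InLanguage X (α ++ γ ++ β)

/-- `X` has the weak specification property. -/
def HasWeakSpecification {A : Type*} (X : Set (ℤ → A)) : Prop :=
  ∃ N : ℕ, ∀ α β : List A, InLanguage X α → InLanguage X β →
    ∃ γ : List A, γ.length ≤ N ∧ InLanguage X (α ++ γ ++ β)

/-- `X` is a subshift of finite type. -/
def IsSFT {A : Type*} (X : Set (ℤ → A)) : Prop :=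
  ∃ F : Set (List A), F.Finite ∧ X = {x | ∀ w ∈ F, ¬ Appears w x}

/-- `X` is sofic: the image of a subshift of finite type under a continuous
shift-commuting map. -/
def IsSofic {A : Type*} [TopologicalSpace A] (X : Set (ℤ → A)) : Prop :=
  ∃ (m : ℕ) (Y : Set (ℤ → Fin m)) (φ : (ℤ → Fin m) → (ℤ → A)),
    IsSFT Y ∧ ContinuousOn φ Y ∧ (∀ y ∈ Y, φ (shiftMap y) = shiftMap (φ y)) ∧
    X = φ '' Y

/-- The adjacency relation of the out-splitting of `G` at `v` with respect to a
bipartition `[E₁, E₂]` of the out-neighbours of `v`; the new vertex `v'` is the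
`Sum.inr` vertex. -/
def outSplitAdj {V : Type*} (Adj : V → V → Prop) (v : V) (E₁ E₂ : Set V) :
    (V ⊕ Unit) → (V ⊕ Unit) → Prop
  | Sum.inl a, Sum.inl b => (a = v ∧ b ∈ E₁) ∨ (a ≠ v ∧ Adj a b)
  | Sum.inl a, Sum.inr _ => Adj a v
  | Sum.inr _, Sum.inl b => b ∈ E₂
  | Sum.inr _, Sum.inr _ => False

/-- The adjacency relation of the in-splitting of `G` at `v` with respect to a
bipartition `[F₁, F₂]` of the in-neighbours of `v`. -/
def inSplitAdj {V : Type*} (Adj : V → V → Prop) (v : V) (F₁ F₂ : Set V) :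
    (V ⊕ Unit) → (V ⊕ Unit) → Prop
  | Sum.inl a, Sum.inl b => (b = v ∧ a ∈ F₁) ∨ (b ≠ v ∧ Adj a b)
  | Sum.inl a, Sum.inr _ => a ∈ F₂
  | Sum.inr _, Sum.inl b => Adj v b
  | Sum.inr _, Sum.inr _ => False

/-- The word `x_k x_{k+1} ⋯ x_{k+n-1}`. -/
def windowWord {A : Type*} (x : ℤ → A) (k : ℤ) (n : ℕ) : List A :=
  (List.range n).map fun i : ℕ => x (k + i)

/-- `C` is invariant under all powers of the shift. -/
def ShiftInvariant {A : Type*} (C : Set (ℤ → A)) : Prop :=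
  ∀ x ∈ C, ∀ k : ℤ, (fun i => x (i + k)) ∈ C

section Words

variable {A B : Type*}

@[simp] lemma length_windowWord (x : ℤ → A) (k : ℤ) (n : ℕ) : (windowWord x k n).length = n := by
  simp [windowWord]

lemma windowWord_add (x : ℤ → A) (k : ℤ) (m n : ℕ) :
    windowWord x k (m + n) = windowWord x k m ++ windowWord x (k + m) n := by
  simp [windowWord, List.range_add, Function.comp_def, add_assoc]

lemma map_windowWord (f : A → B) (x : ℤ → A) (k : ℤ) (n : ℕ) :
    (windowWord x k n).map f = windowWord (f ∘ x) k n := by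
  simp [windowWord]

lemma windowWord_shift (x : ℤ → A) (j k : ℤ) (n : ℕ) :
    windowWord (fun i => x (i + j)) k n = windowWord x (k + j) n := by
  simp [windowWord, add_right_comm]

lemma windowWord_eq_iff (x y : ℤ → A) (k l : ℤ) (n : ℕ) :
    windowWord x k n = windowWord y l n ↔ ∀ i : ℕ, i < n → x (k + i) = y (l + i) := by
  simp [windowWord]

lemma appears_iff (w : List A) (x : ℤ → A) :
    Appears w x ↔ ∃ k, windowWord x k w.length = w := by
  refine exists_congr fun k => ⟨fun h => ?_, fun h i => ?_⟩
  · refine List.ext_getElem (by simp) fun i h1 h2 => ?_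
    simpa [windowWord] using h ⟨i, h2⟩
  · have := List.getElem_of_eq h (i := i) (by simp)
    simpa [windowWord] using this

lemma appears_windowWord (x : ℤ → A) (k : ℤ) (n : ℕ) : Appears (windowWord x k n) x :=
  (appears_iff _ _).2 ⟨k, by simp⟩

lemma inLanguage_windowWord [TopologicalSpace A] {C : Set (ℤ → A)} {x : ℤ → A} (hx : x ∈ C)
    (k : ℤ) (n : ℕ) : InLanguage (closure C) (windowWord x k n) :=
  ⟨x, subset_closure hx, appears_windowWord x k n⟩

variable [TopologicalSpace A] [DiscreteTopology A]

lemma mem_nhds_iff_window (x : ℤ → A) (s : Set (ℤ → A)) :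
    s ∈ 𝓝 x ↔ ∃ r : ℕ, ∀ y, (∀ k : ℤ, -r ≤ k → k ≤ r → y k = x k) → y ∈ s := by
  rw [nhds_pi, Filter.mem_pi]
  constructor
  · rintro ⟨I, hI, t, ht, hs⟩
    obtain ⟨a, ha⟩ := hI.bddAbove
    obtain ⟨b, hb⟩ := hI.bddBelow
    refine ⟨a.toNat + (-b).toNat, fun y hy => hs fun i hi => ?_⟩
    have h1 := ha hi
    have h2 := hb hi
    rw [hy i (by omega) (by omega)]
    exact mem_of_mem_nhds (ht i)
  · rintro ⟨r, hr⟩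
    refine ⟨Set.Icc (-(r : ℤ)) r, Set.finite_Icc _ _, fun i => {x i}, fun i => by simp, ?_⟩
    exact fun y hy => hr y fun k h1 h2 => hy k ⟨h1, h2⟩

lemma mem_closure_iff_window (x : ℤ → A) (C : Set (ℤ → A)) :
    x ∈ closure C ↔ ∀ r : ℕ, ∃ y ∈ C, ∀ k : ℤ, -r ≤ k → k ≤ r → y k = x k := by
  rw [mem_closure_iff_nhds]
  constructor
  · intro h r
    obtain ⟨y, hy, hC⟩ := h {y | ∀ k : ℤ, -r ≤ k → k ≤ r → y k = x k}
      ((mem_nhds_iff_window _ _).2 ⟨r, fun y hy => hy⟩)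
    exact ⟨y, hC, hy⟩
  · intro h s hs
    obtain ⟨r, hr⟩ := (mem_nhds_iff_window _ _).1 hs
    obtain ⟨y, hy, hk⟩ := h r
    exact ⟨y, hr y hk, hy⟩

lemma exists_eqOn_of_mem_closure {x : ℤ → A} {C : Set (ℤ → A)} (hx : x ∈ closure C) (a b : ℤ) :
    ∃ y ∈ C, ∀ k, a ≤ k → k ≤ b → y k = x k := by
  obtain ⟨y, hy, h⟩ := (mem_closure_iff_window x C).1 hx (a.natAbs + b.natAbs)
  exact ⟨y, hy, fun k h1 h2 => h k (by omega) (by omega)⟩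

lemma ShiftInvariant.inLanguage_closure {C : Set (ℤ → A)} (hC : ShiftInvariant C) (w : List A) :
    InLanguage (closure C) w ↔ ∃ x ∈ C, windowWord x 0 w.length = w := by
  constructor
  · rintro ⟨x, hx, hw⟩
    obtain ⟨k, hk⟩ := (appears_iff w x).1 hw
    obtain ⟨y, hy, h⟩ := exists_eqOn_of_mem_closure hx k (k + w.length)
    refine ⟨_, hC y hy k, ?_⟩
    rw [windowWord_shift]
    conv_rhs => rw [← hk]
    rw [windowWord_eq_iff]
    intro i hi
    rw [zero_add]
    exact h _ (by omega) (by omega)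
  · rintro ⟨x, hx, hw⟩
    exact ⟨x, subset_closure hx, (appears_iff w x).2 ⟨0, hw⟩⟩

end Words

section FiniteType

variable {A B : Type*}

lemma IsSFT.inter {X Y : Set (ℤ → A)} (hX : IsSFT X) (hY : IsSFT Y) : IsSFT (X ∩ Y) := by
  obtain ⟨F, hF, rfl⟩ := hX
  obtain ⟨G, hG, rfl⟩ := hY
  refine ⟨F ∪ G, hF.union hG, ?_⟩
  ext x
  simp only [Set.mem_inter_iff, Set.mem_ofPred_eq, Set.mem_union]
  exact ⟨fun h w hw => hw.elim (h.1 w) (h.2 w), fun h => ⟨fun w hw => h w (.inl hw),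
    fun w hw => h w (.inr hw)⟩⟩

lemma IsSFT.preimage_comp [Finite B] {X : Set (ℤ → A)} (hX : IsSFT X) (f : B → A) :
    IsSFT {x : ℤ → B | f ∘ x ∈ X} := by
  obtain ⟨F, hF, rfl⟩ := hX
  refine ⟨List.map f ⁻¹' F, hF.preimage' fun w _ => ?_, ?_⟩
  · refine (List.finite_length_eq B w.length).subset fun u hu => ?_
    have : u.map f = w := hu
    simp [← this]
  · ext x
    simp only [Set.mem_ofPred_eq, Set.mem_preimage]
    refine ⟨fun h w hw hx => h _ hw ?_, fun h w hw hx => ?_⟩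
    · obtain ⟨k, hk⟩ := (appears_iff _ _).1 hx
      exact (appears_iff _ _).2 ⟨k, by rw [List.length_map, ← map_windowWord, hk]⟩
    · obtain ⟨k, hk⟩ := (appears_iff _ _).1 hx
      exact h (windowWord x k w.length) (by rwa [map_windowWord, hk]) (appears_windowWord _ _ _)

/-- A condition on the coordinates in `[-r, r]`, imposed at all positions, defines a subshift of
finite type. -/
lemma isSFT_of_local [Finite A] (r : ℕ) (P : (ℤ → A) → Prop)
    (hP : ∀ x y, (∀ k : ℤ, -r ≤ k → k ≤ r → x k = y k) → P x → P y) :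
    IsSFT {x : ℤ → A | ∀ k : ℤ, P fun i => x (i + k)} := by
  refine ⟨{w | w.length = 2 * r + 1 ∧ ∃ x, windowWord x (-r) (2 * r + 1) = w ∧ ¬ P x},
    (List.finite_length_eq A (2 * r + 1)).subset fun w hw => hw.1, ?_⟩
  ext x
  simp only [Set.mem_ofPred_eq]
  constructor
  · rintro h w ⟨hw, y, hy, hPy⟩ hx
    obtain ⟨k, hk⟩ := (appears_iff _ _).1 hx
    rw [hw, ← hy, windowWord_eq_iff] at hk
    refine hPy (hP _ _ (fun j h1 h2 => ?_) (h (k + r)))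
    have := hk (j + r).toNat (by omega)
    rw [Int.toNat_of_nonneg (by omega)] at this
    convert this using 2 <;> ring
  · intro h k
    by_contra hk
    refine h _ ⟨by simp, _, rfl, hk⟩ ?_
    rw [windowWord_shift]
    exact appears_windowWord _ _ _

lemma IsSFT.shiftInvariant {X : Set (ℤ → A)} (hX : IsSFT X) : ShiftInvariant X := by
  obtain ⟨F, hF, rfl⟩ := hX
  intro x hx k w hw h
  obtain ⟨j, hj⟩ := (appears_iff _ _).1 h
  exact hx w hw ((appears_iff _ _).2 ⟨j + k, by rw [← windowWord_shift, hj]⟩)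

lemma IsSFT.isClosed [TopologicalSpace A] [DiscreteTopology A] {X : Set (ℤ → A)} (hX : IsSFT X) :
    IsClosed X := by
  obtain ⟨F, hF, rfl⟩ := hX
  refine isClosed_of_closure_subset fun x hx w hw h => ?_
  obtain ⟨k, hk⟩ := (appears_iff _ _).1 h
  obtain ⟨y, hy, hyx⟩ := exists_eqOn_of_mem_closure hx k (k + w.length)
  refine hy w hw ((appears_iff _ _).2 ⟨k, ?_⟩)
  conv_rhs => rw [← hk]
  exact (windowWord_eq_iff _ _ _ _ _).2 fun i hi => hyx _ (by omega) (by omega)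

lemma continuous_comp_left [TopologicalSpace A] [DiscreteTopology A] [TopologicalSpace B]
    (f : A → B) : Continuous fun x : ℤ → A => f ∘ x :=
  continuous_pi fun i => continuous_of_discreteTopology.comp (continuous_apply i)

lemma isSofic_image [Finite B] [TopologicalSpace B] [DiscreteTopology B] [TopologicalSpace A]
    {Z : Set (ℤ → B)} (hZ : IsSFT Z) (φ : (ℤ → B) → ℤ → A) (hφ : ContinuousOn φ Z)
    (hs : ∀ z ∈ Z, φ (shiftMap z) = shiftMap (φ z)) : IsSofic (φ '' Z) := by
  obtain ⟨m, ⟨e⟩⟩ := Finite.exists_equiv_fin B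
  refine ⟨m, _, fun y => φ (e.symm ∘ y), hZ.preimage_comp e.symm,
    hφ.comp (continuous_comp_left _).continuousOn fun y hy => hy, fun y hy => hs _ hy, ?_⟩
  ext x
  constructor
  · rintro ⟨z, hz, rfl⟩
    have : e.symm ∘ (e ∘ z) = z := by ext; simp
    exact ⟨e ∘ z, by simpa [this] using hz, by simp [this]⟩
  · rintro ⟨y, hy, rfl⟩
    exact ⟨_, hy, rfl⟩

lemma comm_shift_zpow {X : Set (ℤ → A)} (hX : ShiftInvariant X) {φ : (ℤ → A) → ℤ → B}
    (hs : ∀ z ∈ X, φ (shiftMap z) = shiftMap (φ z)) {x : ℤ → A} (hx : x ∈ X) (k : ℤ) :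
    φ (fun i => x (i + k)) = fun i => φ x (i + k) := by
  induction k using Int.induction_on with
  | zero => simp
  | succ k ih =>
    have h := hs _ (hX x hx k)
    rw [ih] at h
    have h2 : shiftMap (fun i => x (i + (k : ℤ))) = fun i => x (i + (k + 1)) := by
      ext j
      simp only [shiftMap]
      congr 1; ring
    rw [← h2, h]
    ext i
    simp only [shiftMap]
    congr 1; ring
  | pred k ih =>
    have h := hs _ (hX x hx (-k - 1))
    ext i
    have h1 := congrFun h (i - 1)
    have h2 : shiftMap (fun i => x (i + (-(k : ℤ) - 1))) = fun i => x (i + -k) := by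
      ext j
      simp only [shiftMap]
      congr 1; ring
    rw [h2, ih] at h1
    simp only [shiftMap, sub_add_cancel] at h1
    rw [← h1]
    congr 1; ring

/-- The local rule half of the Curtis–Hedlund–Lyndon theorem. -/
lemma exists_local_rule [TopologicalSpace A] [DiscreteTopology A] [Finite A]
    [TopologicalSpace B] [DiscreteTopology B] {Y : Set (ℤ → A)} (hY : IsClosed Y)
    {φ : (ℤ → A) → ℤ → B} (hφ : ContinuousOn φ Y) :
    ∃ r : ℕ, ∀ y ∈ Y, ∀ z ∈ Y, (∀ k : ℤ, -r ≤ k → k ≤ r → y k = z k) → φ y 0 = φ z 0 := by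
  have key : ∀ y ∈ Y, ∃ r : ℕ, ∀ z ∈ Y, (∀ k : ℤ, -r ≤ k → k ≤ r → z k = y k) →
      φ z 0 = φ y 0 := by
    intro y hy
    have h1 : Tendsto (fun z => φ z 0) (𝓝[Y] y) (𝓝 (φ y 0)) :=
      ((continuous_apply (0 : ℤ)).continuousAt.tendsto).comp (hφ y hy)
    have h2 : ∀ᶠ z in 𝓝[Y] y, φ z 0 = φ y 0 := by
      simpa [nhds_discrete, tendsto_pure] using h1
    rw [eventually_nhdsWithin_iff] at h2
    obtain ⟨r, hr⟩ := (mem_nhds_iff_window _ _).1 h2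
    exact ⟨r, fun z hz h => hr z h hz⟩
  choose! r hr using key
  obtain ⟨t, ht, hcov⟩ := hY.isCompact.elim_nhds_subcover
    (fun y => {z | ∀ k : ℤ, -r y ≤ k → k ≤ r y → z k = y k})
    (fun y _ => (mem_nhds_iff_window _ _).2 ⟨r y, fun z hz => hz⟩)
  refine ⟨t.sup r, fun y hy z hz h => ?_⟩
  obtain ⟨u, hu, hyu⟩ := Set.mem_iUnion₂.1 (hcov hy)
  have hle : r u ≤ t.sup r := Finset.le_sup hu
  rw [hr u (ht u hu) y hy hyu, hr u (ht u hu) z hz fun k h1 h2 => ?_]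
  rw [← h k (by omega) (by omega)]
  exact hyu k h1 h2

end FiniteType

/-- The combinatorial relation between the concatenations of a graph `G` (the set `C`) and those of
an out-splitting of `G` at `v` (the set `C'`), where `π` identifies the two copies of `v`. -/
structure IsSplitCover {A B : Type*} (π : B → A) (v : A) (C : Set (ℤ → A)) (C' : Set (ℤ → B)) :
    Prop where
  shift : ShiftInvariant C
  shift' : ShiftInvariant C'
  lift : ∀ x ∈ C, ∃ y ∈ C', π ∘ y = x
  proj : ∀ y ∈ C', π ∘ y ∈ C
  resolving : ∀ y ∈ C', ∀ z ∈ C', ∀ j k : ℤ, y (j + 1) = z (k + 1) → π (y j) = π (z k) → y j = z k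
  unique : ∀ a b, π a = π b → π a ≠ v → a = b
  exit : ∀ x ∈ C, ∀ m, ∃ n ≥ m, x n ≠ v
  lift_exit : ∀ x ∈ C, ∀ y ∈ C', ∀ m k n : ℤ, x m = v → π (y k) = v → m < n → x n ≠ v →
    ∃ z ∈ C', (∀ j ≤ m, π (z j) = x j) ∧ z m = y k ∧ ∃ e, m < e ∧ e ≤ n ∧ π (z e) ≠ v

namespace IsSplitCover

variable {A B : Type*} {π : B → A} {v : A} {C : Set (ℤ → A)} {C' : Set (ℤ → B)}

lemma exists_lift_at (h : IsSplitCover π v C C') {x : ℤ → A} (hx : x ∈ C) {y : ℤ → B}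
    (hy : y ∈ C') (m k : ℤ) (hmk : π (y k) = x m) :
    ∃ z ∈ C', (∀ j ≤ m, π (z j) = x j) ∧ z m = y k := by
  by_cases hv : x m = v
  · obtain ⟨n, hn, hxn⟩ := h.exit x hx m
    have hne : m ≠ n := fun e => hxn (e ▸ hv)
    obtain ⟨z, hz, h1, h2, -⟩ := h.lift_exit x hx y hy m k n hv (hmk.trans hv) (by omega) hxn
    exact ⟨z, hz, h1, h2⟩
  · obtain ⟨z, hz, rfl⟩ := h.lift x hx
    exact ⟨z, hz, fun j _ => rfl, h.unique _ _ hmk.symm hv⟩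

lemma eq_of_eq_last (h : IsSplitCover π v C C') {y z : ℤ → B} (hy : y ∈ C') (hz : z ∈ C')
    {a b : ℤ} (hb : y b = z b) (hπ : ∀ k, a ≤ k → k ≤ b → π (y k) = π (z k)) :
    ∀ k, a ≤ k → k ≤ b → y k = z k := by
  have key : ∀ d : ℕ, a ≤ b - d → y (b - d) = z (b - d) := by
    intro d
    induction d with
    | zero => intro _; simpa using hb
    | succ d ih =>
      intro hd
      push_cast at hd ⊢
      have := ih (by omega)
      refine h.resolving y hy z hz _ _ ?_ (hπ _ hd (by omega))
      convert this using 2 <;> ring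
  intro k h1 h2
  have := key (b - k).toNat (by omega)
  rwa [Int.toNat_of_nonneg (by omega), sub_sub_cancel] at this

/-- The word of length two at position `k` of `y` occurs in `C'`. -/
def Legal (C' : Set (ℤ → B)) (y : ℤ → B) (k : ℤ) : Prop :=
  ∃ z ∈ C', z 0 = y k ∧ z 1 = y (k + 1)

lemma exists_eqOn_of_legal (h : IsSplitCover π v C C') {x : ℤ → A} (hx : x ∈ C) {y : ℤ → B}
    {a b : ℤ} (hxy : ∀ k, a ≤ k → k ≤ b → π (y k) = x k)
    (hl : ∀ k, a ≤ k → k ≤ b → Legal C' y k) (hab : a ≤ b) :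
    ∃ z ∈ C', ∀ k, a ≤ k → k ≤ b → z k = y k := by
  obtain ⟨w, hw, hw0, -⟩ := hl b hab le_rfl
  obtain ⟨z, hz, hzx, hzb⟩ := h.exists_lift_at hx hw b 0 (by rw [hw0, hxy b hab le_rfl])
  refine ⟨z, hz, ?_⟩
  have key : ∀ d : ℕ, a ≤ b - d → z (b - d) = y (b - d) := by
    intro d
    induction d with
    | zero => intro _; simpa [hw0] using hzb
    | succ d ih =>
      intro hd
      push_cast at hd ⊢
      have ih := ih (by omega)
      obtain ⟨u, hu, hu0, hu1⟩ := hl (b - (d + 1)) hd (by omega)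
      have e : b - ((d : ℤ) + 1) + 1 = b - d := by ring
      rw [← hu0]
      refine h.resolving z hz u hu _ 0 ?_ ?_
      · rw [zero_add, hu1, e, ih]
      · rw [hu0, hzx _ (by omega), hxy _ hd (by omega)]
  intro k h1 h2
  have := key (b - k).toNat (by omega)
  rwa [Int.toNat_of_nonneg (by omega), sub_sub_cancel] at this

lemma exists_connect (h : IsSplitCover π v C C') {y z : ℤ → B} (hy : y ∈ C') (hz : z ∈ C')
    {n s b : ℕ} (hn : π (y n) ≠ v) (hns : n < s) {x : ℤ → A} (hx : x ∈ C)
    (hxy : ∀ k : ℤ, 0 ≤ k → k ≤ n → x k = π (y k)) (hxz : ∀ i : ℕ, i < b → x (s + i) = π (z i)) :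
    ∃ q ∈ C', (∀ k : ℤ, 0 ≤ k → k ≤ n → q k = y k) ∧ ∀ i : ℕ, i < b → q (s + i) = z i := by
  obtain ⟨q, hq, hqx, hqz⟩ : ∃ q ∈ C', (∀ k : ℤ, k < s + b → π (q k) = x k) ∧
      ∀ i : ℕ, i < b → q (s + i) = z i := by
    cases b with
    | zero =>
      obtain ⟨q, hq, rfl⟩ := h.lift x hx
      exact ⟨q, hq, fun _ _ => rfl, by simp⟩
    | succ b =>
      obtain ⟨q, hq, hqx, hqb⟩ := h.exists_lift_at hx hz (s + b) b (hxz b (by omega)).symm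
      refine ⟨q, hq, fun k hk => hqx k (by push_cast at hk; omega), fun i hi => ?_⟩
      have := h.eq_of_eq_last (h.shift' q hq s) hz (a := 0) (b := b) (by simpa [add_comm] using hqb)
        (fun k h1 h2 => ?_) i (by omega) (by omega)
      · simpa [add_comm] using this
      · lift k to ℕ using h1
        rw [hqx _ (by omega), add_comm, hxz k (by omega)]
  refine ⟨q, hq, h.eq_of_eq_last hq hy (h.unique _ _ ?_ ?_).symm fun k h1 h2 => ?_, hqz⟩
  · rw [hqx _ (by omega), hxy _ (by omega) le_rfl]
  · exact hn
  · rw [hqx _ (by omega), hxy _ h1 h2]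

lemma isSFT_legal [Finite B] : IsSFT {y : ℤ → B | ∀ k, Legal C' y k} := by
  have := isSFT_of_local (A := B) 1 (fun y => Legal C' y 0) fun x y hxy hx => by
    simpa only [Legal, hxy 0 (by simp) (by simp), zero_add, hxy 1 (by simp) (by simp)] using hx
  simpa [Legal, add_comm] using this

/-- A sequence all of whose words of length two occur in `C` lifts to a sequence all of whose
words of length two occur in `C'`. -/
lemma exists_legal_lift [TopologicalSpace B] [DiscreteTopology B] [Finite B]
    (h : IsSplitCover π v C C') {x : ℤ → A} (hx : ∀ k, ∃ p ∈ C, p k = x k ∧ p (k + 1) = x (k + 1)) :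
    ∃ y : ℤ → B, π ∘ y = x ∧ ∀ k, Legal C' y k := by
  have key : ∀ (m : ℤ) (d : ℕ), ∃ y : ℤ → B, (∃ z ∈ C', z 0 = y (m - d)) ∧
      ∀ k, m - d ≤ k → k ≤ m → π (y k) = x k ∧ (k < m → Legal C' y k) := by
    intro m d
    induction d with
    | zero =>
      obtain ⟨p, hp, hpm, -⟩ := hx m
      obtain ⟨q, hq, rfl⟩ := h.lift p hp
      refine ⟨q, ⟨_, h.shift' q hq m, by simp⟩, fun k k1 k2 => ?_⟩
      obtain rfl : k = m := by simp at k1; omega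
      exact ⟨hpm, by simp⟩
    | succ d ih =>
      obtain ⟨y, ⟨z, hz, hzy⟩, hy⟩ := ih
      obtain ⟨p, hp, hp1, hp2⟩ := hx (m - d - 1)
      rw [sub_add_cancel] at hp2
      obtain ⟨q, hq, hqp, hqz⟩ := h.exists_lift_at hp hz (m - d) 0
        (by rw [hzy, hp2, (hy _ le_rfl (by omega)).1])
      have hne : ∀ k, m - d ≤ k → k ≠ m - d - 1 := fun k hk => by omega
      refine ⟨Function.update y (m - d - 1) (q (m - d - 1)),
        ⟨_, h.shift' q hq (m - d - 1), by
          simp only [zero_add]; push_cast; rw [← sub_sub, Function.update_self]⟩,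
        fun k k1 k2 => ?_⟩
      push_cast at k1
      by_cases hk : m - d ≤ k
      · have := hy k hk k2
        simpa only [Legal, Function.update_of_ne (hne k hk),
          Function.update_of_ne (hne (k + 1) (by omega))] using this
      · obtain rfl : k = m - d - 1 := by omega
        rw [Function.update_self]
        refine ⟨by rw [hqp _ (by omega), hp1], fun _ => ⟨_, h.shift' q hq (m - d - 1), ?_, ?_⟩⟩
        · rw [Function.update_self, zero_add]
        · rw [sub_add_cancel, Function.update_of_ne (hne _ le_rfl), ← hzy, ← hqz]
          congr 1; ring
  let K : ℕ → Set (ℤ → B) := fun n =>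
    {y | ∀ k : ℤ, -n ≤ k → k ≤ n → π (y k) = x k ∧ Legal C' y k}
  have hK : ∀ n, IsClosed (K n) := by
    intro n
    refine isClosed_of_closure_subset fun y hy k k1 k2 => ?_
    obtain ⟨z, hz, hzy⟩ := exists_eqOn_of_mem_closure hy k (k + 1)
    have := hz k k1 k2
    simpa only [Legal, hzy k le_rfl (by omega), hzy (k + 1) (by omega) le_rfl] using this
  obtain ⟨y, hy⟩ := IsCompact.nonempty_iInter_of_sequence_nonempty_isCompact_isClosed K
    (fun n y hy k k1 k2 => hy k (by push_cast; omega) (by push_cast; omega))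
    (fun n => by
      obtain ⟨y, -, hy⟩ := key (n + 1) (2 * n + 1)
      refine ⟨y, fun k k1 k2 => ?_⟩
      have := hy k (by push_cast; omega) (by omega)
      exact ⟨this.1, this.2 (by omega)⟩)
    (hK 0).isCompact hK
  rw [Set.mem_iInter] at hy
  refine ⟨y, ?_, fun k => (hy k.natAbs k (by omega) (by omega)).2⟩
  ext k
  exact (hy k.natAbs k (by omega) (by omega)).1

lemma comp_mem_closure [TopologicalSpace A] [TopologicalSpace B] [DiscreteTopology B]
    (h : IsSplitCover π v C C') {y : ℤ → B} (hy : y ∈ closure C') :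
    π ∘ y ∈ closure C :=
  map_mem_closure (continuous_comp_left π) hy h.proj

lemma exists_inLanguage [TopologicalSpace A] [DiscreteTopology A]
    [TopologicalSpace B] (h : IsSplitCover π v C C') {w : List A}
    (hw : InLanguage (closure C) w) :
    ∃ u, InLanguage (closure C') u ∧ u.map π = w := by
  obtain ⟨x, hx, hxw⟩ := (h.shift.inLanguage_closure w).1 hw
  obtain ⟨y, hy, rfl⟩ := h.lift x hx
  exact ⟨windowWord y 0 w.length, inLanguage_windowWord hy _ _,
    by rw [map_windowWord, hxw]⟩

lemma language_injOn [TopologicalSpace B] [DiscreteTopology B] (h : IsSplitCover π v C C')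
    (n : ℕ) :
    Set.InjOn (fun w : List B => (w.map π, w.getLast?))
      {w | w.length = n ∧ InLanguage (closure C') w} := by
  rintro w ⟨rfl, hw⟩ u ⟨hul, hu⟩ hwu
  obtain ⟨y, hy, hyw⟩ := (h.shift'.inLanguage_closure w).1 hw
  obtain ⟨z, hz, hzu⟩ := (h.shift'.inLanguage_closure u).1 hu
  rw [hul] at hzu
  obtain ⟨h1, h2⟩ := Prod.mk.inj hwu
  rw [← hyw, ← hzu] at h1 h2 ⊢
  cases hn : w.length with
  | zero => simp [windowWord]
  | succ n =>
    rw [hn] at h1 h2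
    rw [map_windowWord, map_windowWord, windowWord_eq_iff] at h1
    simp only [windowWord, List.range_succ, List.map_append, List.map_cons, List.map_nil,
      List.getLast?_append, List.getLast?_singleton, Option.some_or, Option.some.injEq,
      zero_add] at h2
    rw [windowWord_eq_iff]
    intro i hi
    refine h.eq_of_eq_last hy hz h2 (a := 0) (fun k hk1 hk2 => ?_) _ (by omega) (by omega)
    have := h1 k.toNat (by omega)
    rw [zero_add, Int.toNat_of_nonneg hk1] at this
    exact this

/-- A connection of projected words, the first of which extends `α` far enough to reach a letter
with a unique lift, can be lifted. -/
lemma exists_connect_word [TopologicalSpace A] [DiscreteTopology A]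
    [TopologicalSpace B] (h : IsSplitCover π v C C') {y z : ℤ → B}
    (hy : y ∈ C') (hz : z ∈ C')
    {a n l b : ℕ} (hn : π (y n) ≠ v) (han : a ≤ n) (hnl : n < l) {γ : List A}
    (hγ : InLanguage (closure C) ((windowWord y 0 l).map π ++ γ ++ (windowWord z 0 b).map π)) :
    ∃ γ' : List B, γ'.length = l - a + γ.length ∧
      InLanguage (closure C') (windowWord y 0 a ++ γ' ++ windowWord z 0 b) := by
  obtain ⟨x, hx, hw⟩ := (h.shift.inLanguage_closure _).1 hγ
  simp only [List.length_append, length_windowWord, windowWord_add,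
    map_windowWord, zero_add] at hw
  obtain ⟨h12, h3⟩ := List.append_inj hw (by simp)
  obtain ⟨h1, -⟩ := List.append_inj h12 (by simp)
  rw [windowWord_eq_iff] at h1 h3
  obtain ⟨q, hq, hqy, hqz⟩ := h.exists_connect hy hz hn (s := l + γ.length) (b := b) (by omega) hx
    (fun k k1 k2 => by
      lift k to ℕ using k1
      simpa using h1 k (by omega))
    (fun i hi => by simpa using h3 i hi)
  refine ⟨windowWord q a (l - a + γ.length), by simp, ?_⟩
  have e : windowWord y 0 a ++ windowWord q a (l - a + γ.length) ++ windowWord z 0 b =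
      windowWord q 0 (a + (l - a + γ.length) + b) := by
    rw [windowWord_add q 0 (a + _), windowWord_add q 0 a, zero_add, zero_add]
    congr 1
    · congr 1
      rw [windowWord_eq_iff]
      exact fun i hi => (hqy (0 + i) (by omega) (by omega)).symm
    · rw [windowWord_eq_iff]
      intro i hi
      rw [zero_add, ← hqz i hi]
      congr 1
      omega
  rw [e]
  exact inLanguage_windowWord hq _ _

section Closure

variable [TopologicalSpace A] [DiscreteTopology A] [TopologicalSpace B] [DiscreteTopology B]

lemma image_closure [Finite B] (h : IsSplitCover π v C C') :
    closure C = (fun y => π ∘ y) '' closure C' := by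
  apply Set.Subset.antisymm
  · refine closure_minimal (fun x hx => ?_)
      (isClosed_closure.isCompact.image (continuous_comp_left π)).isClosed
    obtain ⟨y, hy, rfl⟩ := h.lift x hx
    exact ⟨y, subset_closure hy, rfl⟩
  · rintro _ ⟨y, hy, rfl⟩
    exact h.comp_mem_closure hy

lemma mem_closure_iff (h : IsSplitCover π v C C') (y : ℤ → B) :
    y ∈ closure C' ↔ π ∘ y ∈ closure C ∧ ∀ k, Legal C' y k := by
  constructor
  · refine fun hy => ⟨h.comp_mem_closure hy, fun k => ?_⟩
    obtain ⟨z, hz, hzy⟩ := exists_eqOn_of_mem_closure hy k (k + 1)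
    refine ⟨_, h.shift' z hz k, ?_, ?_⟩
    · simpa using hzy k (by omega) (by omega)
    · simpa [add_comm] using hzy (k + 1) (by omega) (by omega)
  · rintro ⟨hy, hl⟩
    rw [mem_closure_iff_window]
    intro r
    obtain ⟨x, hx, hxy⟩ := exists_eqOn_of_mem_closure hy (-r) r
    exact h.exists_eqOn_of_legal hx (fun k h1 h2 => (hxy k h1 h2).symm) (fun k _ _ => hl k)
      (by omega)

lemma inLanguage_map (h : IsSplitCover π v C C') {w : List B} (hw : InLanguage (closure C') w) :
    InLanguage (closure C) (w.map π) := by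
  obtain ⟨y, hy, hyw⟩ := (h.shift'.inLanguage_closure w).1 hw
  exact (h.shift.inLanguage_closure _).2
    ⟨_, h.proj y hy, by rw [List.length_map, ← map_windowWord, hyw]⟩

lemma hasEntropy_iff [Finite A] [Finite B] (h : IsSplitCover π v C C') (t : ℝ) :
    HasEntropy (closure C) t ↔ HasEntropy (closure C') t := by
  have hfin : ∀ n, {w : List B | w.length = n ∧ InLanguage (closure C') w}.Finite :=
    fun n => (List.finite_length_eq B n).subset fun w hw => hw.1
  have hfin' : ∀ n, {w : List A | w.length = n ∧ InLanguage (closure C) w}.Finite :=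
    fun n => (List.finite_length_eq A n).subset fun w hw => hw.1
  have hle : ∀ n, {w : List A | w.length = n ∧ InLanguage (closure C) w}.ncard ≤
      {w : List B | w.length = n ∧ InLanguage (closure C') w}.ncard := by
    intro n
    refine le_trans (Set.ncard_le_ncard ?_ ((hfin n).image (List.map π)))
      (Set.ncard_image_le (hfin n))
    rintro w ⟨hl, hw⟩
    obtain ⟨u, hu, rfl⟩ := h.exists_inLanguage hw
    exact ⟨u, ⟨by simpa using hl, hu⟩, rfl⟩
  have hge : ∀ n, {w : List B | w.length = n ∧ InLanguage (closure C') w}.ncard ≤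
      {w : List A | w.length = n ∧ InLanguage (closure C) w}.ncard * Nat.card (Option B) := by
    intro n
    rw [← Set.ncard_univ, ← Set.ncard_prod]
    refine Set.ncard_le_ncard_of_injOn _ ?_ (h.language_injOn n)
      ((hfin' n).prod Set.finite_univ)
    rintro w ⟨hl, hw⟩
    exact ⟨⟨by simpa using hl, h.inLanguage_map hw⟩, trivial⟩
  unfold HasEntropy
  generalize hf : (fun n => {w : List A | w.length = n ∧ InLanguage (closure C) w}.ncard) = f at *
  generalize hg : (fun n => {w : List B | w.length = n ∧ InLanguage (closure C') w}.ncard) = g at *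
  simp only [funext_iff] at hf hg
  simp only [hf, hg] at hle hge ⊢
  have hc : 1 ≤ Nat.card (Option B) := Nat.card_pos
  have hdiff : Tendsto (fun n : ℕ => Real.log (g n) / n - Real.log (f n) / n) atTop (𝓝 0) := by
    refine squeeze_zero_norm (a := fun n : ℕ => Real.log (Nat.card (Option B)) / n) (fun n => ?_)
      (tendsto_const_div_atTop_nhds_zero_nat _)
    have hc0 : 0 ≤ Real.log (Nat.card (Option B)) := Real.log_natCast_nonneg _
    rw [← sub_div, Real.norm_eq_abs, abs_div, Nat.abs_cast]
    gcongr
    rcases Nat.eq_zero_or_pos (f n) with h0 | h0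
    · have : g n = 0 := by have := hge n; simp_all
      simpa [h0, this] using hc0
    · have h1 : (0 : ℝ) < f n := by exact_mod_cast h0
      have h2 : (f n : ℝ) ≤ g n := by exact_mod_cast hle n
      have h3 : (g n : ℝ) ≤ f n * Nat.card (Option B) := by exact_mod_cast hge n
      have h4 := Real.log_le_log h1 h2
      have h5 := Real.log_le_log (h1.trans_le h2) h3
      rw [Real.log_mul h1.ne' (by positivity)] at h5
      rw [abs_of_nonneg (by linarith)]
      linarith
  constructor
  · intro hh
    simpa using hh.add hdiff
  · intro hh
    simpa using hh.sub hdiff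

lemma isMixing (h : IsSplitCover π v C C') (hX : IsMixing (closure C)) :
    IsMixing (closure C') := by
  intro α β hα hβ
  obtain ⟨y, hy, hyα⟩ := (h.shift'.inLanguage_closure _).1 hα
  obtain ⟨z, hz, hzβ⟩ := (h.shift'.inLanguage_closure _).1 hβ
  obtain ⟨n, hn, hyn⟩ := h.exit _ (h.proj y hy) α.length
  lift n to ℕ using by omega
  obtain ⟨N, hN⟩ := hX _ _
    (h.inLanguage_map (inLanguage_windowWord hy 0 (n + 1))) (h.inLanguage_map hβ)
  refine ⟨N + (n + 1 - α.length), fun M hM => ?_⟩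
  obtain ⟨γ, hγ, hL⟩ := hN (M - (n + 1 - α.length)) (by omega)
  rw [← hzβ] at hL
  obtain ⟨γ', hγ', hL'⟩ := h.exists_connect_word hy hz (a := α.length) hyn (by omega)
    (Nat.lt_succ_self n) hL
  rw [hyα, hzβ] at hL'
  exact ⟨γ', by omega, hL'⟩

lemma exists_exit_le (h : IsSplitCover π v C C') {N : ℕ}
    (hN : ∀ α β : List A, InLanguage (closure C) α → InLanguage (closure C) β →
      ∃ γ : List A, γ.length ≤ N ∧ InLanguage (closure C) (α ++ γ ++ β))
    {y : ℤ → B} (hy : y ∈ C') (a : ℕ) :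
    ∃ z ∈ C', windowWord z 0 a = windowWord y 0 a ∧
      ∃ n : ℕ, a ≤ n ∧ n ≤ a + N + 1 ∧ π (z n) ≠ v := by
  by_cases hya : π (y a) = v
  · obtain ⟨m, -, hm⟩ := h.exit _ (h.proj y hy) 0
    obtain ⟨γ, hγ, hL⟩ := hN _ _
      (h.inLanguage_map (inLanguage_windowWord hy 0 (a + 1)))
      (h.inLanguage_map (inLanguage_windowWord hy m 1))
    obtain ⟨x, hx, hw⟩ := (h.shift.inLanguage_closure _).1 hL
    simp only [List.length_append, length_windowWord, map_windowWord] at hw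
    rw [windowWord_add, windowWord_add _ _ (a + 1), zero_add] at hw
    obtain ⟨h12, h3⟩ := List.append_inj hw (by simp)
    obtain ⟨h1, -⟩ := List.append_inj h12 (by simp)
    rw [windowWord_eq_iff] at h1
    rw [windowWord_eq_iff] at h3
    have h3 : π (y m) = x (a + 1 + γ.length : ℕ) := by simpa using (h3 0 (by omega)).symm
    have h1' : ∀ k : ℤ, 0 ≤ k → k ≤ a → x k = π (y k) := by
      intro k k1 k2
      lift k to ℕ using k1
      simpa using h1 k (by omega)
    obtain ⟨z, hz, hzx, hza, e, he1, he2, hev⟩ := h.lift_exit x hx y hy a a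
      (a + 1 + γ.length : ℕ) (by rw [h1' a (by omega) le_rfl, hya]) hya (by push_cast; omega)
      (h3 ▸ hm)
    refine ⟨z, hz, (windowWord_eq_iff _ _ _ _ _).2 fun i hi => ?_, e.toNat, by omega,
      by push_cast at he2; omega, by rwa [Int.toNat_of_nonneg (by omega)]⟩
    refine h.eq_of_eq_last hz hy hza (a := 0) (fun k k1 k2 => ?_) _ (by omega) (by omega)
    rw [hzx k k2, h1' k k1 k2]
  · exact ⟨y, hy, rfl, a, le_rfl, by omega, hya⟩

lemma exists_uniform_connect (h : IsSplitCover π v C C') {N : ℕ}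
    (hN : ∀ α β : List A, InLanguage (closure C) α → InLanguage (closure C) β →
      ∃ γ : List A, γ.length ≤ N ∧ InLanguage (closure C) (α ++ γ ++ β))
    {α β : List B} (hα : InLanguage (closure C') α) (hβ : InLanguage (closure C') β) :
    ∃ α' β' : List A, InLanguage (closure C) α' ∧ InLanguage (closure C) β' ∧
      ∀ γ, InLanguage (closure C) (α' ++ γ ++ β') → ∃ γ' : List B,
        γ'.length = N + 2 + γ.length ∧ InLanguage (closure C') (α ++ γ' ++ β) := by
  obtain ⟨y, hy, hyα⟩ := (h.shift'.inLanguage_closure _).1 hα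
  obtain ⟨z, hz, hzβ⟩ := (h.shift'.inLanguage_closure _).1 hβ
  obtain ⟨u, hu, huy, n, hn1, hn2, hun⟩ := h.exists_exit_le hN hy α.length
  refine ⟨_, _, h.inLanguage_map (inLanguage_windowWord hu 0 (α.length + N + 2)),
    h.inLanguage_map hβ, fun γ hL => ?_⟩
  rw [← hzβ] at hL
  obtain ⟨γ', hγ', hL'⟩ := h.exists_connect_word hu hz (a := α.length) hun hn1 (by omega) hL
  rw [huy, hyα, hzβ] at hL'
  exact ⟨γ', by omega, hL'⟩

lemma hasWeakSpecification_iff (h : IsSplitCover π v C C') :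
    HasWeakSpecification (closure C) ↔ HasWeakSpecification (closure C') := by
  constructor
  · rintro ⟨N, hN⟩
    refine ⟨N + 2 + N, fun α β hα hβ => ?_⟩
    obtain ⟨α', β', hα', hβ', hL⟩ := h.exists_uniform_connect hN hα hβ
    obtain ⟨γ, hγ, hγL⟩ := hN α' β' hα' hβ'
    obtain ⟨γ', hγ', hL'⟩ := hL γ hγL
    exact ⟨γ', by omega, hL'⟩
  · rintro ⟨N, hN⟩
    refine ⟨N, fun α β hα hβ => ?_⟩
    obtain ⟨α, hα', rfl⟩ := h.exists_inLanguage hα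
    obtain ⟨β, hβ', rfl⟩ := h.exists_inLanguage hβ
    obtain ⟨γ, hγ, hL⟩ := hN α β hα' hβ'
    exact ⟨γ.map π, by simpa using hγ, by simpa using h.inLanguage_map hL⟩

lemma hasSpecification_iff (h : IsSplitCover π v C C') :
    HasSpecification (closure C) ↔ HasSpecification (closure C') := by
  constructor
  · rintro ⟨N, hN⟩
    refine ⟨N + 2 + N, fun α β hα hβ => ?_⟩
    obtain ⟨α', β', hα', hβ', hL⟩ := h.exists_uniform_connect (N := N)
      (fun α β hα hβ => (hN α β hα hβ).imp fun γ hγ => ⟨hγ.1.le, hγ.2⟩) hα hβ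
    obtain ⟨γ, hγ, hγL⟩ := hN α' β' hα' hβ'
    obtain ⟨γ', hγ', hL'⟩ := hL γ hγL
    exact ⟨γ', by omega, hL'⟩
  · rintro ⟨N, hN⟩
    refine ⟨N, fun α β hα hβ => ?_⟩
    obtain ⟨α, hα', rfl⟩ := h.exists_inLanguage hα
    obtain ⟨β, hβ', rfl⟩ := h.exists_inLanguage hβ
    obtain ⟨γ, hγ, hL⟩ := hN α β hα' hβ'
    exact ⟨γ.map π, by simpa using hγ, by simpa using h.inLanguage_map hL⟩

lemma closure_eq_inter (h : IsSplitCover π v C C') :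
    closure C' = {y | π ∘ y ∈ closure C} ∩ {y | ∀ k, Legal C' y k} :=
  Set.ext h.mem_closure_iff

lemma isSFT_iff [Finite A] [Finite B] (h : IsSplitCover π v C C') :
    IsSFT (closure C) ↔ IsSFT (closure C') := by
  constructor
  · intro hX
    rw [h.closure_eq_inter]
    exact (hX.preimage_comp π).inter isSFT_legal
  · rintro ⟨F, hF, hX⟩
    obtain ⟨N, hN⟩ := (hF.image List.length).bddAbove
    have hN : ∀ w ∈ F, w.length ≤ N := fun w hw => hN ⟨w, hw, rfl⟩
    have := isSFT_of_local (A := A) (N + 1)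
      (fun x => ∃ p ∈ C, ∀ k : ℤ, -(N + 1 : ℕ) ≤ k → k ≤ (N + 1 : ℕ) → p k = x k)
      fun x y hxy ⟨p, hp, hpx⟩ => ⟨p, hp, fun k k1 k2 => by rw [hpx k k1 k2, hxy k k1 k2]⟩
    convert this using 1
    ext x
    constructor
    · intro hx k
      obtain ⟨p, hp, hpx⟩ := exists_eqOn_of_mem_closure hx (-(N + 1 : ℕ) + k) ((N + 1 : ℕ) + k)
      exact ⟨_, h.shift p hp k, fun j j1 j2 => hpx _ (by omega) (by omega)⟩
    · intro hx
      have hx' : ∀ k : ℤ, ∃ p ∈ C, ∀ j : ℤ, k ≤ j → j ≤ k + N + 1 → p j = x j := by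
        intro k
        obtain ⟨p, hp, hpx⟩ := hx k
        refine ⟨_, h.shift p hp (-k), fun j j1 j2 => ?_⟩
        simpa using hpx (j + -k) (by push_cast; omega) (by push_cast; omega)
      obtain ⟨y, rfl, hl⟩ := h.exists_legal_lift (x := x) fun k => by
        obtain ⟨p, hp, hpx⟩ := hx' k
        exact ⟨p, hp, hpx k (by omega) (by omega), hpx _ (by omega) (by omega)⟩
      refine h.comp_mem_closure ?_
      rw [hX]
      intro w hw hwy
      obtain ⟨k, hk⟩ := (appears_iff _ _).1 hwy
      obtain ⟨p, hp, hpy⟩ := hx' k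
      obtain ⟨q, hq, hqy⟩ := h.exists_eqOn_of_legal hp (y := y) (a := k) (b := k + N + 1)
        (fun j j1 j2 => (hpy j j1 j2).symm) (fun j _ _ => hl j) (by omega)
      have hq' : q ∈ closure C' := subset_closure hq
      rw [hX] at hq'
      refine hq' w hw ((appears_iff _ _).2 ⟨k, ?_⟩)
      conv_rhs => rw [← hk]
      have := hN w hw
      exact (windowWord_eq_iff _ _ _ _ _).2 fun i hi => hqy _ (by omega) (by omega)

lemma isSofic_iff [Finite B] (h : IsSplitCover π v C C') :
    IsSofic (closure C) ↔ IsSofic (closure C') := by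
  constructor
  · rintro ⟨m, Y, φ, hY, hφ, hs, hX⟩
    obtain ⟨r, hr⟩ := exists_local_rule hY.isClosed hφ
    let P : (ℤ → Fin m × B) → Prop := fun z =>
      ∃ y ∈ Y, (∀ k : ℤ, -r ≤ k → k ≤ r → y k = (z k).1) ∧ φ y 0 = π (z 0).2
    have hP := isSFT_of_local (A := Fin m × B) r P fun z w hzw ⟨y, hy, hyz, h0⟩ =>
      ⟨y, hy, fun k k1 k2 => by rw [hyz k k1 k2, hzw k k1 k2],
        by rw [h0, hzw 0 (by omega) (by omega)]⟩
    have hZ := ((hY.preimage_comp (B := Fin m × B) Prod.fst).inter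
      ((isSFT_legal (C' := C')).preimage_comp (B := Fin m × B) Prod.snd)).inter hP
    have hsof := isSofic_image hZ (fun z => Prod.snd ∘ z)
      (continuous_comp_left Prod.snd).continuousOn fun z _ => rfl
    convert hsof using 1
    rw [h.closure_eq_inter]
    ext x
    constructor
    · rintro ⟨hx, hl⟩
      have hx : π ∘ x ∈ closure C := hx
      rw [hX] at hx
      obtain ⟨y, hy, hyx⟩ := hx
      refine ⟨fun i => (y i, x i), ⟨⟨hy, hl⟩, fun k => ⟨_, hY.shiftInvariant y hy k,
        fun j _ _ => rfl, ?_⟩⟩, rfl⟩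
      rw [comm_shift_zpow hY.shiftInvariant hs hy k, hyx]
      rfl
    · rintro ⟨z, ⟨⟨hzY, hl⟩, hz⟩, rfl⟩
      refine ⟨?_, hl⟩
      rw [Set.mem_ofPred_eq, hX]
      refine ⟨Prod.fst ∘ z, hzY, ?_⟩
      ext k
      obtain ⟨y, hy, hyz, h0⟩ := hz k
      have h1 := hr _ hy _ (hY.shiftInvariant _ hzY k) hyz
      rw [comm_shift_zpow hY.shiftInvariant hs hzY k, h0] at h1
      simpa using h1.symm
  · rintro ⟨m, Y, φ, hY, hφ, hs, hX⟩
    refine ⟨m, Y, fun y => π ∘ φ y, hY, (continuous_comp_left π).comp_continuousOn hφ,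
      fun y hy => ?_, ?_⟩
    · simp only [hs y hy]
      rfl
    · rw [h.image_closure, hX, Set.image_image]

end Closure

end IsSplitCover

section Graph

variable {V W : Type*}

/-- `x` is the concatenation of the blocks `a i ^ (t (i + 1) - t i)`, where the `i`-th block starts
at `t i`, along a walk of the set-equipped graph. -/
structure IsConcatenation (Adj : V → V → Prop) (S : V → Set ℕ) (x : ℤ → V) (a : ℤ → V)
    (t : ℤ → ℤ) : Prop where
  strictMono : StrictMono t
  mem : ∀ i, (t (i + 1) - t i).toNat ∈ S (a i)
  adj : ∀ i, Adj (a i) (a (i + 1))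
  eq : ∀ i k, t i ≤ k → k < t (i + 1) → x k = a i
  cover : ∀ m, ∃ i, t i ≤ m ∧ m < t (i + 1)

lemma mem_sGraphCore_iff {Adj : V → V → Prop} {S : V → Set ℕ} {x : ℤ → V} :
    x ∈ SGraphCore Adj S ↔ ∃ a t, IsConcatenation Adj S x a t :=
  ⟨fun ⟨a, t, h1, h2, h3, h4, h5⟩ => ⟨a, t, h1, h2, h3, h4, h5⟩,
    fun ⟨a, t, h⟩ => ⟨a, t, h.1, h.2, h.3, h.4, h.5⟩⟩

namespace IsConcatenation

variable {Adj : V → V → Prop} {S : V → Set ℕ} {x y a b : ℤ → V} {t s : ℤ → ℤ}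

lemma lt_succ (h : IsConcatenation Adj S x a t) (i : ℤ) : t i < t (i + 1) :=
  h.strictMono (by omega)

lemma apply_start (h : IsConcatenation Adj S x a t) (i : ℤ) : x (t i) = a i :=
  h.eq i _ le_rfl (h.lt_succ i)

/-- Two concatenations may be spliced, following `x` up to its `i`-th block, which is refilled with
the letter of the `j`-th block of `y`, and `y` afterwards. -/
lemma exists_splice (hx : IsConcatenation Adj S x a t) (hy : IsConcatenation Adj S y b s)
    (i j : ℤ) (hadj : Adj (a (i - 1)) (b j)) (hmem : (t (i + 1) - t i).toNat ∈ S (b j)) :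
    ∃ z ∈ SGraphCore Adj S, (∀ k < t i, z k = x k) ∧
      (∀ k, t i ≤ k → k < t (i + 1) → z k = b j) ∧ z (t (i + 1)) = b (j + 1) := by
  have hi := hx.lt_succ i
  have hs : ∀ l, i ≤ l → s (l + 1 - i + j) - s (j + 1) + t (i + 1) =
      s (l - i + j + 1) - s (j + 1) + t (i + 1) := fun l _ => by congr 3; ring
  refine ⟨fun k => if k < t i then x k else if k < t (i + 1) then b j else
    y (k - t (i + 1) + s (j + 1)), mem_sGraphCore_iff.2
      ⟨fun l => if l < i then a l else b (l - i + j),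
        fun l => if l ≤ i then t l else s (l - i + j) - s (j + 1) + t (i + 1), ?_, ?_, ?_, ?_, ?_⟩,
      fun k hk => if_pos hk, fun k h1 h2 => ?_, ?_⟩
  · refine strictMono_int_of_lt_succ fun l => ?_
    rcases lt_trichotomy l i with h | rfl | h
    · rw [if_pos h.le, if_pos (by omega)]
      exact hx.lt_succ l
    · rw [if_pos le_rfl, if_neg (by omega), hs l le_rfl]
      simpa [add_comm] using hi
    · rw [if_neg (by omega), if_neg (by omega), hs l h.le]
      have := hy.lt_succ (l - i + j)
      omega
  · intro l
    rcases lt_trichotomy l i with h | rfl | h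
    · rw [if_pos h.le, if_pos (by omega), if_pos (by omega)]
      exact hx.mem l
    · rw [if_pos le_rfl, if_neg (by omega), if_neg (by omega), hs l le_rfl]
      simpa [add_comm] using hmem
    · rw [if_neg (by omega), if_neg (by omega), if_neg (by omega), hs l h.le]
      have := hy.mem (l - i + j)
      convert this using 2
      ring
  · intro l
    by_cases h : l < i
    · rw [if_pos h]
      by_cases h' : l + 1 < i
      · rw [if_pos h']
        exact hx.adj l
      · obtain rfl : i = l + 1 := by omega
        rw [if_neg h']
        simpa using hadj
    · rw [if_neg h, if_neg (by omega)]
      have := hy.adj (l - i + j)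
      convert this using 2
      ring
  · intro l k h1 h2
    rcases lt_trichotomy l i with h | rfl | h
    · rw [if_pos h.le] at h1
      rw [if_pos (by omega)] at h2
      have : t (l + 1) ≤ t i := hx.strictMono.monotone (by omega)
      rw [if_pos (by omega), if_pos h, hx.eq l k h1 h2]
    · rw [if_pos le_rfl] at h1
      rw [if_neg (by omega), hs l le_rfl] at h2
      have h3 : k < t (l + 1) := by simpa [add_comm] using h2
      rw [if_neg (by omega), if_pos h3, if_neg (by omega), sub_self, zero_add]
    · rw [if_neg (by omega)] at h1
      rw [if_neg (by omega), hs l h.le] at h2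
      have : s (j + 1) ≤ s (l - i + j) := hy.strictMono.monotone (by omega)
      rw [if_neg (by omega), if_neg (by omega), if_neg (by omega)]
      exact hy.eq _ _ (by omega) (by omega)
  · intro m
    by_cases h1 : m < t i
    · obtain ⟨l, hl1, hl2⟩ := hx.cover m
      have : l < i := hx.strictMono.lt_iff_lt.1 (by omega)
      exact ⟨l, by rwa [if_pos this.le], by rwa [if_pos (by omega)]⟩
    · by_cases h2 : m < t (i + 1)
      · refine ⟨i, by rw [if_pos le_rfl]; omega, ?_⟩
        rw [if_neg (by omega), hs i le_rfl]
        simpa [add_comm] using h2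
      · obtain ⟨l, hl1, hl2⟩ := hy.cover (m - t (i + 1) + s (j + 1))
        have : j + 1 < l + 1 := hy.strictMono.lt_iff_lt.1 (by omega)
        refine ⟨l - j + i, ?_, ?_⟩
        · rw [if_neg (by omega), show l - j + i - i + j = l by ring]
          omega
        · rw [if_neg (by omega), show l - j + i + 1 - i + j = l + 1 by ring]
          omega
  · simp only
    rw [if_neg (by omega), if_pos h2]
  · simp only
    rw [if_neg (by omega), if_neg (by omega), sub_self, zero_add, hy.apply_start]

lemma shift (h : IsConcatenation Adj S x a t) (k : ℤ) :
    IsConcatenation Adj S (fun i => x (i + k)) a (fun i => t i - k) where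
  strictMono i j hij := by simpa using h.strictMono hij
  mem i := by simpa using h.mem i
  adj := h.adj
  eq i j h1 h2 := h.eq i _ (by omega) (by omega)
  cover m := by
    obtain ⟨i, h1, h2⟩ := h.cover (m + k)
    exact ⟨i, by omega, by omega⟩

lemma reverse (h : IsConcatenation Adj S x a t) :
    IsConcatenation (flip Adj) S (fun i => x (-i)) (fun i => a (-i - 1)) (fun i => 1 - t (-i)) where
  strictMono i j hij := by
    have := h.strictMono (neg_lt_neg hij)
    simp only
    omega
  mem i := by
    have := h.mem (-i - 1)
    rw [sub_add_cancel] at this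
    convert this using 2
    rw [neg_add']
    ring
  adj i := by
    have := h.adj (-i - 1 - 1)
    rw [sub_add_cancel] at this
    rwa [flip, neg_add']
  eq i k h1 h2 := by
    rw [neg_add'] at h2
    exact h.eq _ _ (by omega) (by rw [sub_add_cancel]; omega)
  cover m := by
    obtain ⟨i, h1, h2⟩ := h.cover (-m)
    refine ⟨-(i + 1), ?_, ?_⟩
    · rw [neg_neg]
      omega
    · rw [show -(-(i + 1) + 1) = i by ring]
      omega

lemma eq_or_adj (h : IsConcatenation Adj S x a t) (k : ℤ) :
    x (k + 1) = x k ∨ Adj (x k) (x (k + 1)) := by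
  obtain ⟨i, h1, h2⟩ := h.cover k
  rw [h.eq i k h1 h2]
  rcases eq_or_lt_of_le (show k + 1 ≤ t (i + 1) by omega) with h3 | h3
  · right
    rw [h3, h.apply_start]
    exact h.adj i
  · exact Or.inl (h.eq i _ (by omega) h3)

end IsConcatenation

lemma shiftInvariant_sGraphCore (Adj : V → V → Prop) (S : V → Set ℕ) :
    ShiftInvariant (SGraphCore Adj S) := by
  intro x hx k
  obtain ⟨a, t, h⟩ := mem_sGraphCore_iff.1 hx
  exact mem_sGraphCore_iff.2 ⟨a, _, h.shift k⟩

lemma reverse_mem_sGraphCore_iff (Adj : V → V → Prop) (S : V → Set ℕ) (x : ℤ → V) :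
    (fun i => x (-i)) ∈ SGraphCore Adj S ↔ x ∈ SGraphCore (flip Adj) S := by
  simp only [mem_sGraphCore_iff]
  constructor
  · rintro ⟨a, t, h⟩
    exact ⟨_, _, by simpa using h.reverse⟩
  · rintro ⟨a, t, h⟩
    exact ⟨_, _, h.reverse⟩

lemma isSplitCover_sGraphCore {Adj : V → V → Prop} {S : V → Set ℕ} {v : V}
    {Adj' : W → W → Prop} {π : W → V} (hloop : ∀ u, ¬ Adj u u)
    (hadj : ∀ a b, Adj' a b → Adj (π a) (π b))
    (htwin : ∀ a b c, Adj' a b → π b = π c → Adj' a c)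
    (hres : ∀ a b c, Adj' a c → Adj' b c → π a = π b → a = b)
    (hlift : ∀ a b, Adj a b → ∃ a', π a' = a ∧ ∀ b', π b' = b → Adj' a' b')
    (huniq : ∀ a b, π a = π b → π a ≠ v → a = b) :
    IsSplitCover π v (SGraphCore Adj S) (SGraphCore Adj' (S ∘ π)) := by
  choose f hfπ hf using hlift
  have hliftc : ∀ x a t, IsConcatenation Adj S x a t → ∃ x' a',
      IsConcatenation Adj' (S ∘ π) x' a' t ∧ π ∘ x' = x ∧ π ∘ a' = a := by
    intro x a t h
    choose i hi1 hi2 using h.cover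
    have hfa : ∀ i, π (f (a i) (a (i + 1)) (h.adj i)) = a i := fun i => hfπ _ _ _
    have hblock : ∀ l k, t l ≤ k → k < t (l + 1) → i k = l := fun l k h1 h2 => by
      have h3 := h.strictMono.lt_iff_lt.1 ((hi1 k).trans_lt h2)
      have h4 := h.strictMono.lt_iff_lt.1 (h1.trans_lt (hi2 k))
      omega
    refine ⟨fun k => f (a (i k)) (a (i k + 1)) (h.adj (i k)),
      fun i => f (a i) (a (i + 1)) (h.adj i),
      ⟨h.strictMono, fun l => ?_, fun l => hf _ _ _ _ (hfa _), fun l k h1 h2 => ?_,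
        h.cover⟩, ?_, ?_⟩
    · simpa [hfa] using h.mem l
    · rw [hblock l k h1 h2]
    · ext k
      simpa [hfa] using (h.eq _ _ (hi1 k) (hi2 k)).symm
    · ext k
      simp [hfa]
  refine ⟨shiftInvariant_sGraphCore _ _, shiftInvariant_sGraphCore _ _, ?_, ?_, ?_, huniq, ?_, ?_⟩
  · intro x hx
    obtain ⟨a, t, h⟩ := mem_sGraphCore_iff.1 hx
    obtain ⟨x', a', h', hx', -⟩ := hliftc x a t h
    exact ⟨x', mem_sGraphCore_iff.2 ⟨a', t, h'⟩, hx'⟩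
  · intro y hy
    obtain ⟨a, t, h⟩ := mem_sGraphCore_iff.1 hy
    exact mem_sGraphCore_iff.2 ⟨π ∘ a, t, h.strictMono, h.mem, fun i => hadj _ _ (h.adj i),
      fun i k h1 h2 => congrArg π (h.eq i k h1 h2), h.cover⟩
  · intro y hy z hz j k hjk hπ
    obtain ⟨a, t, h⟩ := mem_sGraphCore_iff.1 hy
    obtain ⟨b, s, h'⟩ := mem_sGraphCore_iff.1 hz
    rcases h.eq_or_adj j with h1 | h1 <;> rcases h'.eq_or_adj k with h2 | h2
    · rw [← h1, ← h2, hjk]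
    · rw [← hjk, h1] at h2
      exact absurd (hπ ▸ hadj _ _ h2) (hloop _)
    · rw [hjk, h2] at h1
      exact absurd (hπ ▸ hadj _ _ h1) (hloop _)
    · exact hres _ _ _ h1 (hjk ▸ h2) hπ
  · intro x hx m
    obtain ⟨a, t, h⟩ := mem_sGraphCore_iff.1 hx
    by_cases hm : x m = v
    · obtain ⟨i, h1, h2⟩ := h.cover m
      refine ⟨t (i + 1), h2.le, fun e => ?_⟩
      rw [h.apply_start] at e
      rw [h.eq i m h1 h2] at hm
      have := h.adj i
      rw [hm, e] at this
      exact hloop _ this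
    · exact ⟨m, le_rfl, hm⟩
  · intro x hx y hy m k n hxm hyk hmn hxn
    obtain ⟨a, t, h⟩ := mem_sGraphCore_iff.1 hx
    obtain ⟨b, s, hb⟩ := mem_sGraphCore_iff.1 hy
    obtain ⟨i, hi1, hi2⟩ := h.cover m
    obtain ⟨j, hj1, hj2⟩ := hb.cover k
    obtain ⟨x', a', h', rfl, rfl⟩ := hliftc x a t h
    have hai : π (a' i) = v := by rw [← hxm]; exact (h.eq i m hi1 hi2).symm
    rw [hb.eq j k hj1 hj2] at hyk ⊢
    obtain ⟨z, hz, hz1, hz2, hz3⟩ := h'.exists_splice hb i j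
      (htwin _ (a' i) _ (by simpa using h'.adj (i - 1)) (hai.trans hyk.symm))
      (by simpa [hai, hyk] using h'.mem i)
    refine ⟨z, hz, fun l hl => ?_, hz2 m hi1 hi2, t (i + 1), hi2, ?_, ?_⟩
    · by_cases hli : l < t i
      · rw [hz1 l hli]
        rfl
      · rw [hz2 l (by omega) (by omega), hyk, h.eq i l (by omega) (by omega)]
        exact hai.symm
    · by_contra hn
      exact hxn ((h.eq i n (by omega) (by omega)).trans hai)
    · intro e
      rw [hz3] at e
      have := hadj _ _ (hb.adj j)
      rw [e, hyk] at this
      exact hloop _ this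

lemma isSplitCover_outSplit (Adj : V → V → Prop) (S : V → Set ℕ) (v : V)
    (hloop : ∀ u, ¬ Adj u u) (E₁ E₂ : Set V) (hE : ∀ u, Adj v u ↔ (u ∈ E₁ ∨ u ∈ E₂))
    (hdisj : ∀ u, ¬ (u ∈ E₁ ∧ u ∈ E₂)) :
    IsSplitCover (Sum.elim id fun _ : Unit => v) v (SGraphCore Adj S)
      (SGraphCore (outSplitAdj Adj v E₁ E₂) (Sum.elim S fun _ => S v)) := by
  have hS : (Sum.elim S fun _ : Unit => S v) = S ∘ Sum.elim id fun _ : Unit => v := by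
    ext (u | u) <;> rfl
  have hv := hloop v
  have hv1 : v ∉ E₁ := fun h => hv ((hE v).2 (.inl h))
  have hv2 : v ∉ E₂ := fun h => hv ((hE v).2 (.inr h))
  rw [hS]
  refine isSplitCover_sGraphCore hloop ?_ ?_ ?_ ?_ ?_
  · rintro (a | a) (b | b) <;> simp only [outSplitAdj, Sum.elim_inl, Sum.elim_inr, id] <;> grind
  · rintro (a | a) (b | b) (c | c) <;> simp only [outSplitAdj, Sum.elim_inl, Sum.elim_inr, id] <;>
      grind
  · rintro (a | a) (b | b) (c | c) <;> simp only [outSplitAdj, Sum.elim_inl, Sum.elim_inr, id] <;>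
      grind
  · intro a b hab
    by_cases ha : a = v ∧ b ∉ E₁
    · refine ⟨Sum.inr (), ha.1.symm, ?_⟩
      rintro (c | c) <;> simp only [outSplitAdj, Sum.elim_inl, Sum.elim_inr, id] <;> grind
    · refine ⟨Sum.inl a, rfl, ?_⟩
      rintro (c | c) <;> simp only [outSplitAdj, Sum.elim_inl, Sum.elim_inr, id] <;> grind
  · rintro (a | a) (b | b) <;> simp only [Sum.elim_inl, Sum.elim_inr, id] <;> grind

lemma flip_inSplitAdj (Adj : V → V → Prop) (v : V) (F₁ F₂ : Set V) :
    flip (inSplitAdj Adj v F₁ F₂) = outSplitAdj (flip Adj) v F₁ F₂ := by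
  ext (a | a) (b | b) <;> rfl

end Graph

section Reverse

variable {A : Type*}

lemma windowWord_reverse (x : ℤ → A) (k : ℤ) (n : ℕ) :
    windowWord (fun i => x (-i)) k n = (windowWord x (1 - k - n) n).reverse := by
  refine List.ext_getElem (by simp) fun i h1 h2 => ?_
  simp only [length_windowWord] at h1
  simp only [windowWord, List.getElem_map, List.getElem_range, List.getElem_reverse,
    List.length_map, List.length_range]
  congr 1
  omega

lemma appears_reverse_iff (w : List A) (x : ℤ → A) :
    Appears w (fun i => x (-i)) ↔ Appears w.reverse x := by
  simp only [appears_iff, windowWord_reverse, List.length_reverse, List.reverse_eq_iff]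
  exact ⟨fun ⟨k, hk⟩ => ⟨_, hk⟩, fun ⟨k, hk⟩ => ⟨1 - k - w.length, by
    rw [← hk]
    congr 1
    omega⟩⟩

lemma inLanguage_of_reverse {X Y : Set (ℤ → A)} (h : ∀ x, (fun i => x (-i)) ∈ X ↔ x ∈ Y)
    (w : List A) : InLanguage X w ↔ InLanguage Y w.reverse := by
  constructor
  · rintro ⟨x, hx, hw⟩
    refine ⟨fun i => x (-i), (h _).1 (by simpa using hx), ?_⟩
    rw [appears_reverse_iff, List.reverse_reverse]
    exact hw
  · rintro ⟨x, hx, hw⟩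
    exact ⟨_, (h x).2 hx, (appears_reverse_iff w x).2 hw⟩

lemma reverse_symm {X Y : Set (ℤ → A)} (h : ∀ x, (fun i => x (-i)) ∈ X ↔ x ∈ Y) (x : ℤ → A) :
    (fun i => x (-i)) ∈ Y ↔ x ∈ X := by
  rw [← h]
  simp

lemma hasEntropy_of_reverse {X Y : Set (ℤ → A)} (h : ∀ x, (fun i => x (-i)) ∈ X ↔ x ∈ Y) (t : ℝ) :
    HasEntropy X t ↔ HasEntropy Y t := by
  have : ∀ n : ℕ, {w : List A | w.length = n ∧ InLanguage X w}.ncard =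
      {w : List A | w.length = n ∧ InLanguage Y w}.ncard := by
    intro n
    rw [← Set.ncard_image_of_injective _ List.reverse_injective]
    congr 1
    ext w
    simp only [Set.mem_image, Set.mem_ofPred_eq, inLanguage_of_reverse h]
    exact ⟨fun ⟨u, hu, hw⟩ => hw ▸ ⟨by simpa using hu.1, hu.2⟩,
      fun hw => ⟨w.reverse, ⟨by simpa using hw.1, by simpa using hw.2⟩, by simp⟩⟩
  simp only [HasEntropy, this]

lemma isMixing_of_reverse {X Y : Set (ℤ → A)} (h : ∀ x, (fun i => x (-i)) ∈ X ↔ x ∈ Y)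
    (hX : IsMixing X) : IsMixing Y := by
  have hL := inLanguage_of_reverse (reverse_symm h)
  intro α β hα hβ
  obtain ⟨N, hN⟩ := hX _ _ ((hL β).1 hβ) ((hL α).1 hα)
  refine ⟨N, fun n hn => ?_⟩
  obtain ⟨γ, hγ, hw⟩ := hN n hn
  exact ⟨γ.reverse, by simpa using hγ, (hL _).2 (by simpa using hw)⟩

lemma hasSpecification_of_reverse {X Y : Set (ℤ → A)} (h : ∀ x, (fun i => x (-i)) ∈ X ↔ x ∈ Y)
    (hX : HasSpecification X) : HasSpecification Y := by
  have hL := inLanguage_of_reverse (reverse_symm h)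
  obtain ⟨N, hN⟩ := hX
  refine ⟨N, fun α β hα hβ => ?_⟩
  obtain ⟨γ, hγ, hw⟩ := hN _ _ ((hL β).1 hβ) ((hL α).1 hα)
  exact ⟨γ.reverse, by simpa using hγ, (hL _).2 (by simpa using hw)⟩

lemma hasWeakSpecification_of_reverse {X Y : Set (ℤ → A)}
    (h : ∀ x, (fun i => x (-i)) ∈ X ↔ x ∈ Y) (hX : HasWeakSpecification X) :
    HasWeakSpecification Y := by
  have hL := inLanguage_of_reverse (reverse_symm h)
  obtain ⟨N, hN⟩ := hX
  refine ⟨N, fun α β hα hβ => ?_⟩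
  obtain ⟨γ, hγ, hw⟩ := hN _ _ ((hL β).1 hβ) ((hL α).1 hα)
  exact ⟨γ.reverse, by simpa using hγ, (hL _).2 (by simpa using hw)⟩

lemma isSFT_of_reverse {X Y : Set (ℤ → A)} (h : ∀ x, (fun i => x (-i)) ∈ X ↔ x ∈ Y)
    (hX : IsSFT X) : IsSFT Y := by
  obtain ⟨F, hF, rfl⟩ := hX
  refine ⟨List.reverse '' F, hF.image _, ?_⟩
  ext x
  rw [← h]
  simp [appears_reverse_iff]

lemma continuous_reverse [TopologicalSpace A] : Continuous fun (x : ℤ → A) (i : ℤ) => x (-i) :=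
  continuous_pi fun i => continuous_apply (-i)

lemma isSofic_of_reverse [TopologicalSpace A] {X Y : Set (ℤ → A)}
    (h : ∀ x, (fun i => x (-i)) ∈ X ↔ x ∈ Y) (hX : IsSofic X) : IsSofic Y := by
  obtain ⟨m, Z, φ, hZ, hφ, hs, hX⟩ := hX
  refine ⟨m, {z | (fun i => z (-i)) ∈ Z}, fun z i => φ (fun i => z (-i)) (-i),
    isSFT_of_reverse (fun x => Iff.rfl) hZ, ?_, fun z hz => ?_, ?_⟩
  · exact continuous_reverse.comp_continuousOn
      (hφ.comp continuous_reverse.continuousOn fun z hz => hz)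
  · have := comm_shift_zpow hZ.shiftInvariant hs hz (-1)
    ext i
    have := congrFun this (-i)
    simpa [shiftMap, neg_add, add_comm] using this
  · ext x
    rw [← h, hX]
    constructor
    · rintro ⟨z, hz, hzx⟩
      refine ⟨fun i => z (-i), by simpa using hz, ?_⟩
      ext i
      simp [hzx]
    · rintro ⟨z, hz, rfl⟩
      exact ⟨_, hz, by simp⟩

lemma reverse_mem_closure_iff [TopologicalSpace A] {C D : Set (ℤ → A)}
    (h : ∀ x, (fun i => x (-i)) ∈ C ↔ x ∈ D) (x : ℤ → A) :
    (fun i => x (-i)) ∈ closure C ↔ x ∈ closure D := by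
  constructor
  · intro hx
    simpa using map_mem_closure continuous_reverse hx fun y hy => (reverse_symm h y).2 hy
  · exact fun hx => map_mem_closure continuous_reverse hx fun y hy => (h y).2 hy

end Reverse

/-- **State splitting.**  Let `(G',S')` be an out-splitting or an in-splitting
of the set-equipped graph `(G,S)` at a vertex `v` (so `S'` agrees with `S` on
old vertices and assigns `S_v` to the new vertex `v'`).  Then `X(G',S')` has
the same entropy as `X(G,S)`; it is mixing if `X(G,S)` is; it has the weak
specification property (resp. the specification property) iff `X(G,S)` does;
and it is an SFT (resp. sofic) iff `X(G,S)` is. -/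
theorem stateSplitting_preserves {V : Type*} [Fintype V] [DecidableEq V]
    [TopologicalSpace V] [DiscreteTopology V]
    (Adj : V → V → Prop) (S : V → Set ℕ) (v : V)
    (hLoop : ∀ u, ¬ Adj u u)
    (hNe : ∀ u, (S u).Nonempty) (hPos : ∀ u, 0 ∉ S u)
    (Adj' : (V ⊕ Unit) → (V ⊕ Unit) → Prop)
    (hsplit :
      (∃ E₁ E₂ : Set V, (∀ u, Adj v u ↔ (u ∈ E₁ ∨ u ∈ E₂)) ∧
        (∀ u, ¬ (u ∈ E₁ ∧ u ∈ E₂)) ∧ Adj' = outSplitAdj Adj v E₁ E₂) ∨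
      (∃ F₁ F₂ : Set V, (∀ u, Adj u v ↔ (u ∈ F₁ ∨ u ∈ F₂)) ∧
        (∀ u, ¬ (u ∈ F₁ ∧ u ∈ F₂)) ∧ Adj' = inSplitAdj Adj v F₁ F₂)) :
    (∀ h : ℝ, HasEntropy (closure (SGraphCore Adj S)) h ↔
      HasEntropy (closure (SGraphCore Adj' (Sum.elim S fun _ => S v))) h) ∧
    (IsMixing (closure (SGraphCore Adj S)) →
      IsMixing (closure (SGraphCore Adj' (Sum.elim S fun _ => S v)))) ∧
    (HasWeakSpecification (closure (SGraphCore Adj S)) ↔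
      HasWeakSpecification (closure (SGraphCore Adj' (Sum.elim S fun _ => S v)))) ∧
    (HasSpecification (closure (SGraphCore Adj S)) ↔
      HasSpecification (closure (SGraphCore Adj' (Sum.elim S fun _ => S v)))) ∧
    (IsSFT (closure (SGraphCore Adj S)) ↔
      IsSFT (closure (SGraphCore Adj' (Sum.elim S fun _ => S v)))) ∧
    (IsSofic (closure (SGraphCore Adj S)) ↔
      IsSofic (closure (SGraphCore Adj' (Sum.elim S fun _ => S v)))) := by
  rcases hsplit with ⟨E₁, E₂, hE, hdisj, rfl⟩ | ⟨F₁, F₂, hF, hdisj, rfl⟩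
  · have h := isSplitCover_outSplit Adj S v hLoop E₁ E₂ hE hdisj
    exact ⟨h.hasEntropy_iff, h.isMixing, h.hasWeakSpecification_iff, h.hasSpecification_iff,
      h.isSFT_iff, h.isSofic_iff⟩
  · have h := isSplitCover_outSplit (flip Adj) S v hLoop F₁ F₂ hF hdisj
    rw [← flip_inSplitAdj] at h
    have hr := reverse_mem_closure_iff (reverse_mem_sGraphCore_iff Adj S)
    have hr' := reverse_mem_closure_iff
      (reverse_mem_sGraphCore_iff (inSplitAdj Adj v F₁ F₂) (Sum.elim S fun _ => S v))
    have hs := reverse_symm hr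
    have hs' := reverse_symm hr'
    exact ⟨fun t => (hasEntropy_of_reverse hr t).trans
        ((h.hasEntropy_iff t).trans (hasEntropy_of_reverse hs' t)),
      fun hX => isMixing_of_reverse hs' (h.isMixing (isMixing_of_reverse hr hX)),
      ⟨fun hX => hasWeakSpecification_of_reverse hs'
          (h.hasWeakSpecification_iff.1 (hasWeakSpecification_of_reverse hr hX)),
        fun hX => hasWeakSpecification_of_reverse hs
          (h.hasWeakSpecification_iff.2 (hasWeakSpecification_of_reverse hr' hX))⟩,
      ⟨fun hX => hasSpecification_of_reverse hs'
          (h.hasSpecification_iff.1 (hasSpecification_of_reverse hr hX)),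
        fun hX => hasSpecification_of_reverse hs
          (h.hasSpecification_iff.2 (hasSpecification_of_reverse hr' hX))⟩,
      ⟨fun hX => isSFT_of_reverse hs' (h.isSFT_iff.1 (isSFT_of_reverse hr hX)),
        fun hX => isSFT_of_reverse hs (h.isSFT_iff.2 (isSFT_of_reverse hr' hX))⟩,
      ⟨fun hX => isSofic_of_reverse hs' (h.isSofic_iff.1 (isSofic_of_reverse hr hX)),
        fun hX => isSofic_of_reverse hs (h.isSofic_iff.2 (isSofic_of_reverse hr' hX))⟩⟩
end

section
/- Let (G,S) be a set-equipped graph with G irreducible. The S-graph shift X(G,S) has topological entropy 0 if and only if G is a directed cycle and every set S_v ∈ S is a singleton. -/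
open Filter Topology

/-- The graph is a directed cycle: its vertices can be enumerated
`v₀, …, v_{p−1}` so that its edges are exactly `(v_i, v_{(i+1) mod p})`. -/
def IsDirectedCycle {V : Type*} [Fintype V] (Adj : V → V → Prop) : Prop :=
  ∃ e : Fin (Fintype.card V) ≃ V, ∀ i j : Fin (Fintype.card V),
    Adj (e i) (e j) ↔ (j : ℕ) = ((i : ℕ) + 1) % Fintype.card V

/-- `IsBlockWalk Adj S u v l`: the list `l` of blocks (vertex, multiplicity) follows a walk of the
graph from `u` to `v` in which the final vertex `v` carries no block. -/
def IsBlockWalk {V : Type*} (Adj : V → V → Prop) (S : V → Set ℕ) : V → V → List (V × ℕ) → Prop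
  | u, v, [] => u = v
  | u, v, b :: l => b.1 = u ∧ b.2 ∈ S u ∧ ∃ u', Adj u u' ∧ IsBlockWalk Adj S u' v l

/-- The word spelled by a list of blocks. -/
def blockWord {V : Type*} (l : List (V × ℕ)) : List V :=
  l.flatMap fun b => List.replicate b.2 b.1

section Words

variable {V : Type*} {Adj : V → V → Prop} {S : V → Set ℕ}

@[simp] theorem blockWord_nil : blockWord ([] : List (V × ℕ)) = [] := rfl

@[simp] theorem blockWord_cons (b : V × ℕ) (l : List (V × ℕ)) :
    blockWord (b :: l) = List.replicate b.2 b.1 ++ blockWord l := rfl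

@[simp] theorem blockWord_append (l l' : List (V × ℕ)) :
    blockWord (l ++ l') = blockWord l ++ blockWord l' := by
  simp [blockWord]

theorem IsBlockWalk.append {u v w : V} {l l' : List (V × ℕ)} (h : IsBlockWalk Adj S u v l)
    (h' : IsBlockWalk Adj S v w l') : IsBlockWalk Adj S u w (l ++ l') := by
  induction l generalizing u with
  | nil => obtain rfl : u = v := h; exact h'
  | cons b l ih =>
    obtain ⟨h1, h2, u', h3, h4⟩ := h
    exact ⟨h1, h2, u', h3, ih h4⟩

theorem IsBlockWalk.flatMap {α : Type*} {v : V} {f : α → List (V × ℕ)}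
    (h : ∀ c, IsBlockWalk Adj S v v (f c)) (cs : List α) :
    IsBlockWalk Adj S v v (cs.flatMap f) := by
  induction cs with
  | nil => rfl
  | cons c cs ih => exact (h c).append ih

theorem exists_isBlockWalk (hNe : ∀ v, (S v).Nonempty) {u v : V}
    (h : Relation.TransGen Adj u v) : ∃ l, IsBlockWalk Adj S u v l ∧ l ≠ [] := by
  induction h using Relation.TransGen.head_induction_on with
  | @single a h =>
    obtain ⟨n, hn⟩ := hNe a
    exact ⟨[(_, n)], ⟨rfl, hn, v, h, rfl⟩, by simp⟩
  | @head a _ h _ ih =>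
    obtain ⟨n, hn⟩ := hNe a
    obtain ⟨l, hl, -⟩ := ih
    exact ⟨(_, n) :: l, ⟨rfl, hn, _, h, hl⟩, by simp⟩

theorem IsBlockWalk.blockWord_zero (hPos : ∀ v, 0 ∉ S v) {u v : V} {l : List (V × ℕ)}
    (h : IsBlockWalk Adj S u v l) (hl : l ≠ []) : (blockWord l)[0]? = some u := by
  cases l with
  | nil => exact absurd rfl hl
  | cons b l =>
    obtain ⟨rfl, h2, -⟩ := h
    obtain ⟨b, n⟩ := b
    cases n with
    | zero => exact absurd h2 (hPos _)
    | succ n => simp [List.replicate_succ]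

/-- The vertex of the `i`-th block of a walk with final vertex `v`. -/
def blockVertex (v : V) (l : List (V × ℕ)) (i : ℕ) : V := (l.map Prod.fst).getD i v

theorem IsBlockWalk.blockVertex_zero {u v : V} {l : List (V × ℕ)} (h : IsBlockWalk Adj S u v l) :
    blockVertex v l 0 = u := by
  cases l with
  | nil => exact Eq.symm h
  | cons b l => exact h.1

theorem IsBlockWalk.adj_blockVertex {u v : V} {l : List (V × ℕ)} (h : IsBlockWalk Adj S u v l)
    {i : ℕ} (hi : i < l.length) : Adj (blockVertex v l i) (blockVertex v l (i + 1)) := by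
  induction l generalizing u i with
  | nil => simp at hi
  | cons b l ih =>
    obtain ⟨h1, h2, u', h3, h4⟩ := h
    cases i with
    | zero =>
      have := h4.blockVertex_zero
      simp only [blockVertex, List.map_cons, List.getD_cons_succ, List.getD_cons_zero] at this ⊢
      rw [this, h1]
      exact h3
    | succ i =>
      simpa [blockVertex] using ih h4 (by simpa using hi)

theorem IsBlockWalk.mem {u v : V} {l : List (V × ℕ)} (h : IsBlockWalk Adj S u v l)
    {b : V × ℕ} (hb : b ∈ l) : b.2 ∈ S b.1 := by
  induction l generalizing u with
  | nil => simp at hb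
  | cons c l ih =>
    obtain ⟨rfl, h2, u', h3, h4⟩ := h
    rcases List.mem_cons.1 hb with rfl | hb
    · exact h2
    · exact ih h4 hb

theorem exists_int_partial_sums (n : ℤ → ℕ) : ∃ t : ℤ → ℤ, t 0 = 0 ∧ ∀ i, t (i + 1) - t i = n i := by
  refine ⟨fun i => match i with
    | Int.ofNat k => ∑ j ∈ Finset.range k, (n j : ℤ)
    | Int.negSucc k => -∑ j ∈ Finset.range (k + 1), (n (Int.negSucc j) : ℤ), rfl, fun i => ?_⟩
  match i with
  | Int.ofNat k =>
    change ∑ j ∈ Finset.range (k + 1), (n j : ℤ) - ∑ j ∈ Finset.range k, (n j : ℤ) = n k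
    rw [Finset.sum_range_succ]; ring
  | Int.negSucc 0 =>
    change (0 : ℤ) - -∑ j ∈ Finset.range 1, (n (Int.negSucc j) : ℤ) = _
    simp
  | Int.negSucc (k + 1) =>
    change -∑ j ∈ Finset.range (k + 1), (n (Int.negSucc j) : ℤ)
      - -∑ j ∈ Finset.range (k + 1 + 1), (n (Int.negSucc j) : ℤ) = _
    rw [Finset.sum_range_succ _ (k + 1)]; ring

theorem StrictMono.exists_int_mem_Ico {t : ℤ → ℤ} (ht : StrictMono t) (m : ℤ) :
    ∃ i, t i ≤ m ∧ m < t (i + 1) := by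
  have hmono : Monotone fun i => t i - i := by
    refine monotone_int_of_le_succ fun i => ?_
    have := ht (lt_add_one i)
    omega
  have hbdd : ∀ z, t z ≤ m → z ≤ max 0 (m - t 0) := by
    intro z hz
    by_contra! hlt
    have := hmono (show (0 : ℤ) ≤ z by omega)
    simp only at this
    omega
  have hex : ∃ z, t z ≤ m := by
    refine ⟨min 0 (m - t 0), ?_⟩
    have := hmono (min_le_left 0 (m - t 0))
    simp only at this
    omega
  obtain ⟨i, hi, hmax⟩ := Int.exists_greatest_of_bdd ⟨_, hbdd⟩ hex
  refine ⟨i, hi, ?_⟩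
  by_contra! h
  have := hmax _ h
  omega

theorem StrictMono.int_Ico_unique {t : ℤ → ℤ} (ht : StrictMono t) {i j m : ℤ}
    (hi : t i ≤ m) (hi' : m < t (i + 1)) (hj : t j ≤ m) (hj' : m < t (j + 1)) : i = j := by
  rcases lt_trichotomy i j with h | h | h
  · have := ht.monotone (show i + 1 ≤ j by omega)
    omega
  · exact h
  · have := ht.monotone (show j + 1 ≤ i by omega)
    omega

theorem getElem?_blockWord_of_blocks {a : ℤ → V} {n : ℤ → ℕ} {t : ℤ → ℤ} {x : ℤ → V}
    (ht : ∀ i, t (i + 1) - t i = n i)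
    (hx : ∀ i k : ℤ, t i ≤ k → k < t (i + 1) → x k = a i) (l : List (V × ℕ)) (i : ℤ)
    (hl : ∀ j : ℕ, j < l.length → l[j]? = some (a (i + j), n (i + j))) (p : ℕ)
    (hp : p < (blockWord l).length) : (blockWord l)[p]? = some (x (t i + p)) := by
  induction l generalizing i p with
  | nil => simp at hp
  | cons b l ih =>
    have hb : b = (a i, n i) := by simpa using hl 0 (by simp)
    subst hb
    have hti := ht i
    rw [blockWord_cons]
    by_cases h : p < n i
    · rw [List.getElem?_append_left (by simpa using h), List.getElem?_replicate_of_lt h,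
        hx i _ (by omega) (by omega)]
    · rw [List.getElem?_append_right (by simpa using h), List.length_replicate]
      rw [ih (i + 1)]
      · congr 2
        simp only
        omega
      · intro j hj
        have := hl (j + 1) (by simpa using hj)
        simpa [add_assoc, add_comm (1 : ℤ)] using this
      · simp at hp ⊢
        omega

/-- The word of a closed walk appears in a point of the core. -/
theorem IsBlockWalk.inLanguage (hPos : ∀ v, 0 ∉ S v) {v : V} {l : List (V × ℕ)}
    (h : IsBlockWalk Adj S v v l) (hl : l ≠ []) : InLanguage (SGraphCore Adj S) (blockWord l) := by
  have hN : 0 < l.length := List.length_pos_iff.2 hl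
  let r : ℤ → ℕ := fun i => (i % l.length).toNat
  have hr : ∀ i, r i < l.length := fun i => by
    have := Int.emod_lt_of_pos i (show (0 : ℤ) < l.length by omega)
    have := Int.emod_nonneg i (show (l.length : ℤ) ≠ 0 by omega)
    simp only [r]
    omega
  let a : ℤ → V := fun i => (l[r i]'(hr i)).1
  let n : ℤ → ℕ := fun i => (l[r i]'(hr i)).2
  have hav : ∀ i, a i = blockVertex v l (r i) := fun i => by
    have := hr i
    simp [a, blockVertex, List.getD_eq_getElem?_getD, this]
  have hn : ∀ i, n i ∈ S (a i) := fun i => h.mem (List.getElem_mem _)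
  have hn0 : ∀ i, 0 < n i := fun i =>
    Nat.pos_of_ne_zero fun h0 => hPos _ (h0 ▸ hn i)
  have hAdj : ∀ i, Adj (a i) (a (i + 1)) := by
    intro i
    have hs : blockVertex v l (r (i + 1)) = blockVertex v l (r i + 1) := by
      by_cases hlast : r i + 1 = l.length
      · have h0 : r (i + 1) = 0 := by
          have h1 := Int.emod_nonneg i (show (l.length : ℤ) ≠ 0 by omega)
          have h2 : (i + 1) % (l.length : ℤ) = 0 := by
            rw [Int.add_emod_eq_add_emod_right (n := (l.length : ℤ)) (m := i) (k := i % l.length) 1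
              (by simp)]
            simp only [r] at hlast
            rw [show i % (l.length : ℤ) + 1 = l.length by omega, Int.emod_self]
          simp [r, h2]
        rw [h0, hlast, h.blockVertex_zero]
        simp [blockVertex]
      · congr 1
        have h1 := Int.emod_nonneg i (show (l.length : ℤ) ≠ 0 by omega)
        have h3 := hr i
        have h2 : (i + 1) % (l.length : ℤ) = i % l.length + 1 := by
          rw [Int.add_emod_eq_add_emod_right (n := (l.length : ℤ)) (m := i) (k := i % l.length) 1
            (by simp)]
          simp only [r] at hlast h3
          exact Int.emod_eq_of_lt (by omega) (by omega)
        simp only [r, h2]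
        omega
    rw [hav, hav, hs]
    exact h.adj_blockVertex (hr i)
  obtain ⟨t, ht0, ht⟩ := exists_int_partial_sums n
  have htm : StrictMono t := strictMono_int_of_lt_succ fun i => by
    have := ht i
    have := hn0 i
    omega
  choose idx hidx hidx' using htm.exists_int_mem_Ico
  have hx : ∀ i k : ℤ, t i ≤ k → k < t (i + 1) → a (idx k) = a i := fun i k h1 h2 => by
    rw [htm.int_Ico_unique (hidx k) (hidx' k) h1 h2]
  refine ⟨fun k => a (idx k), ⟨a, t, htm, fun i => ?_, hAdj, hx, htm.exists_int_mem_Ico⟩, 0,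
    fun p => ?_⟩
  · rw [ht i]
    exact hn i
  · have := getElem?_blockWord_of_blocks (x := fun k => a (idx k)) ht hx l 0 (fun j hj => ?_) p p.2
    · rw [ht0, List.getElem?_eq_getElem p.2] at this
      exact (Option.some.inj this).symm
    · have : r j = j := by
        simp only [r]
        rw [Int.emod_eq_of_lt (by omega) (by omega)]
        simp
      simp [a, n, this, hj]

theorem InLanguage.mono {X Y : Set (ℤ → V)} (hXY : X ⊆ Y) {w : List V} (h : InLanguage X w) :
    InLanguage Y w := by
  obtain ⟨x, hx, hw⟩ := h
  exact ⟨x, hXY hx, hw⟩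

theorem inLanguage_closure [TopologicalSpace V] [DiscreteTopology V] {X : Set (ℤ → V)}
    {w : List V} (h : InLanguage (closure X) w) : InLanguage X w := by
  obtain ⟨x, hx, k, hk⟩ := h
  have ho : IsOpen {y : ℤ → V | ∀ i : Fin w.length, y (k + (i : ℕ)) = w.get i} := by
    rw [Set.ofPred_forall]
    refine isOpen_iInter_of_finite fun i => ?_
    have hcont : Continuous fun y : ℤ → V => y (k + (i : ℕ)) := continuous_apply _
    exact (isOpen_discrete {w.get i}).preimage hcont
  obtain ⟨y, hy, hyX⟩ := mem_closure_iff.1 hx _ ho hk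
  exact ⟨y, hyX, k, hy⟩

theorem eq_of_flatMap_eq_of_length_eq {α β : Type*} {f : α → List β} {L : ℕ}
    (hf : Function.Injective f) (hL : ∀ c, (f c).length = L) {cs ds : List α}
    (hlen : cs.length = ds.length) (h : cs.flatMap f = ds.flatMap f) : cs = ds := by
  induction cs generalizing ds with
  | nil => simpa using hlen.symm
  | cons c cs ih =>
    cases ds with
    | nil => simp at hlen
    | cons d ds =>
      rw [List.flatMap_cons, List.flatMap_cons] at h
      obtain ⟨h1, h2⟩ := List.append_inj h (by rw [hL, hL])
      rw [hf h1, ih (by simpa using hlen) h2]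

/-- Two equally long distinct words that can be freely concatenated prevent zero entropy. -/
theorem not_hasEntropy_zero_of_free_words [Finite V] {X : Set (ℤ → V)} {L : ℕ}
    (f : Bool → List V) (hf : Function.Injective f) (hL : ∀ c, (f c).length = L)
    (hX : ∀ cs : List Bool, cs ≠ [] → InLanguage X (cs.flatMap f)) : ¬ HasEntropy X 0 := by
  intro hE
  have hL0 : 0 < L := by
    rcases Nat.eq_zero_or_pos L with h | h
    · have h1 := hL true
      have h2 := hL false
      rw [h, List.length_eq_zero_iff] at h1 h2
      exact absurd (hf (h1.trans h2.symm)) (by decide)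
    · exact h
  have hcount : ∀ m : ℕ, 0 < m →
      2 ^ m ≤ {w : List V | w.length = m * L ∧ InLanguage X w}.ncard := by
    intro m hm
    have hfin : {w : List V | w.length = m * L ∧ InLanguage X w}.Finite :=
      (List.finite_length_eq V (m * L)).subset fun w hw => hw.1
    let g : (Fin m → Bool) → List V := fun c => (List.ofFn c).flatMap f
    have hg : Function.Injective g := fun c d hcd =>
      List.ofFn_injective (eq_of_flatMap_eq_of_length_eq hf hL (by simp) hcd)
    have hrange : Set.range g ⊆ {w : List V | w.length = m * L ∧ InLanguage X w} := by
      rintro _ ⟨c, rfl⟩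
      refine ⟨?_, hX _ ?_⟩
      · simp [g, List.length_flatMap, hL, Function.comp_def]
      · intro h
        have := congrArg List.length h
        simp at this
        omega
    calc 2 ^ m = (Set.range g).ncard := by
          rw [← Set.image_univ, Set.ncard_image_of_injective _ hg, Set.ncard_univ]
          simp
      _ ≤ _ := Set.ncard_le_ncard hrange hfin
  have hlog : 0 < Real.log 2 / L := by
    have := Real.log_pos one_lt_two
    positivity
  obtain ⟨N, hN⟩ := (hE.eventually (gt_mem_nhds hlog)).exists_forall_of_atTop
  have hlt := hN ((N + 1) * L) (by nlinarith)
  have hge := hcount (N + 1) N.succ_pos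
  have hge' : ((N + 1 : ℕ) : ℝ) * Real.log 2 ≤
      Real.log ({w : List V | w.length = (N + 1) * L ∧ InLanguage X w}.ncard) := by
    rw [← Real.log_pow]
    exact Real.log_le_log (by positivity) (by exact_mod_cast hge)
  have hLr : (0 : ℝ) < L := by exact_mod_cast hL0
  rw [Nat.cast_mul, div_lt_div_iff₀ (by positivity) hLr] at hlt
  nlinarith

theorem not_hasEntropy_zero_of_walks [Finite V] [TopologicalSpace V] (hPos : ∀ v, 0 ∉ S v)
    {v : V} {l₁ l₂ : List (V × ℕ)} (h₁ : IsBlockWalk Adj S v v l₁) (h₂ : IsBlockWalk Adj S v v l₂)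
    {s : ℕ} {u₁ u₂ : V} (hu₁ : (blockWord l₁)[s]? = some u₁) (hu₂ : (blockWord l₂)[s]? = some u₂)
    (hne : u₁ ≠ u₂) : ¬ HasEntropy (closure (SGraphCore Adj S)) 0 := by
  let g : Bool → List (V × ℕ) := fun c => if c then l₁ ++ l₂ else l₂ ++ l₁
  have hg : ∀ c, IsBlockWalk Adj S v v (g c) := fun c => by
    cases c
    · exact h₂.append h₁
    · exact h₁.append h₂
  have hdiff : blockWord (g true) ≠ blockWord (g false) := by
    intro h
    have h' := congrArg (fun w => w[s]?) h
    obtain ⟨hs₁, -⟩ := List.getElem?_eq_some_iff.1 hu₁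
    obtain ⟨hs₂, -⟩ := List.getElem?_eq_some_iff.1 hu₂
    simp only [g, if_true, blockWord_append, Bool.false_eq_true, if_false,
      List.getElem?_append_left hs₁, List.getElem?_append_left hs₂, hu₁, hu₂] at h'
    exact hne (Option.some.inj h')
  refine not_hasEntropy_zero_of_free_words (L := (blockWord l₁).length + (blockWord l₂).length)
    (fun c => blockWord (g c)) ?_ ?_ ?_
  · intro c d hcd
    cases c <;> cases d
    · rfl
    · exact absurd hcd.symm hdiff
    · exact absurd hcd hdiff
    · rfl
  · intro c
    cases c <;> simp [g, add_comm]
  · intro cs hcs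
    have hw : (cs.flatMap fun c => blockWord (g c)) = blockWord (cs.flatMap g) := by
      simp [blockWord, List.flatMap_assoc]
    rw [hw]
    refine ((IsBlockWalk.flatMap hg cs).inLanguage hPos ?_).mono subset_closure
    intro h0
    obtain ⟨c, cs, rfl⟩ := List.exists_cons_of_ne_nil hcs
    have hc : g c = [] := (List.append_eq_nil_iff.1 h0).1
    have h1 : l₁ = [] := by
      cases c
      · exact (List.append_eq_nil_iff.1 hc).2
      · exact (List.append_eq_nil_iff.1 hc).1
    simp [h1] at hu₁

theorem isDirectedCycle_of_forall_adj_iff [Fintype V] (hIrr : ∀ u v, Relation.TransGen Adj u v)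
    {f : V → V} (hf : ∀ u v, Adj u v ↔ v = f u) : IsDirectedCycle Adj := by
  rcases isEmpty_or_nonempty V with hV | ⟨⟨v₀⟩⟩
  · exact ⟨(Fintype.equivFin V).symm, fun i => (hV.false ((Fintype.equivFin V).symm i)).elim⟩
  have hreach : ∀ v, ∃ n, 0 < n ∧ f^[n] v₀ = v := by
    intro v
    induction hIrr v₀ v with
    | single h => exact ⟨1, one_pos, ((hf _ _).1 h).symm⟩
    | tail _ h ih =>
      obtain ⟨n, -, hn⟩ := ih
      exact ⟨n + 1, n.succ_pos, by rw [Function.iterate_succ_apply', hn, (hf _ _).1 h]⟩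
  have hp : 0 < Function.minimalPeriod f v₀ := by
    obtain ⟨n, hn, hn'⟩ := hreach v₀
    exact Function.IsPeriodicPt.minimalPeriod_pos hn hn'
  have hinj : ∀ i j, i < Function.minimalPeriod f v₀ → j < Function.minimalPeriod f v₀ →
      f^[i] v₀ = f^[j] v₀ → i = j := fun i j hi hj h =>
    Function.iterate_injOn_Iio_minimalPeriod hi hj h
  have hbij : Function.Bijective fun i : Fin (Function.minimalPeriod f v₀) => f^[i] v₀ := by
    refine ⟨fun i j h => Fin.ext (hinj _ _ i.2 j.2 h), fun v => ?_⟩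
    obtain ⟨n, -, hn⟩ := hreach v
    exact ⟨⟨n % Function.minimalPeriod f v₀, Nat.mod_lt _ hp⟩, by
      simpa [Function.iterate_mod_minimalPeriod_eq] using hn⟩
  have hcard : Fintype.card V = Function.minimalPeriod f v₀ := by
    rw [← Fintype.card_of_bijective hbij, Fintype.card_fin]
  rw [IsDirectedCycle, hcard]
  refine ⟨Equiv.ofBijective _ hbij, fun i j => ?_⟩
  simp only [Equiv.ofBijective_apply]
  rw [hf, ← Function.iterate_succ_apply' f, ← Function.iterate_mod_minimalPeriod_eq (n := _ + 1)]
  exact ⟨hinj _ _ j.2 (Nat.mod_lt _ hp), fun h => by rw [h]⟩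

theorem IsDirectedCycle.exists_succ [Fintype V] (h : IsDirectedCycle Adj) :
    ∃ f : V → V, ∀ u v, Adj u v → v = f u := by
  obtain ⟨e, he⟩ := h
  refine ⟨fun u => e ⟨((e.symm u : ℕ) + 1) % Fintype.card V,
    Nat.mod_lt _ (Fintype.card_pos_iff.2 ⟨u⟩)⟩, fun u v huv => ?_⟩
  rw [← e.symm_apply_eq]
  refine Fin.ext ((he _ _).1 ?_)
  simpa using huv

theorem hasEntropy_zero_of_succ [Fintype V] [TopologicalSpace V] [DiscreteTopology V]
    {f : V → V} (hf : ∀ u v, Adj u v → v = f u) {s : V → ℕ} (hs : ∀ v, S v = {s v}) :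
    HasEntropy (closure (SGraphCore Adj S)) 0 := by
  let T : V × ℕ → V × ℕ := fun p => if p.2 + 1 < s p.1 then (p.1, p.2 + 1) else (f p.1, 0)
  let F : Finset (V × ℕ) := Finset.univ ×ˢ Finset.range (Finset.univ.sup s)
  have hcount : ∀ n : ℕ,
      {w : List V | w.length = n ∧ InLanguage (closure (SGraphCore Adj S)) w}.ncard ≤ F.card := by
    intro n
    let g : V × ℕ → List V := fun p => List.ofFn fun i : Fin n => (T^[i] p).1
    have hsub : {w : List V | w.length = n ∧ InLanguage (closure (SGraphCore Adj S)) w} ⊆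
        g '' (F : Set (V × ℕ)) := by
      rintro w ⟨rfl, hw⟩
      obtain ⟨x, ⟨a, t, htm, hS, hAdj, hx, hcov⟩, k, hk⟩ := inLanguage_closure hw
      have hts : ∀ i, t (i + 1) - t i = s (a i) := fun i => by
        have h1 := hS i
        rw [hs, Set.mem_singleton_iff] at h1
        have := htm (lt_add_one i)
        omega
      obtain ⟨i₀, hi₀, hi₀'⟩ := hcov k
      have hT : ∀ m : ℕ, ∃ i, t i ≤ k + m ∧ k + m < t (i + 1) ∧
          T^[m] (a i₀, (k - t i₀).toNat) = (a i, (k + m - t i).toNat) := by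
        intro m
        induction m with
        | zero => exact ⟨i₀, by simpa using hi₀, by simpa using hi₀', by simp⟩
        | succ m ih =>
          obtain ⟨i, h1, h2, h3⟩ := ih
          have hti := hts i
          rw [Function.iterate_succ_apply', h3]
          by_cases hlt : (k + m - t i).toNat + 1 < s (a i)
          · refine ⟨i, by omega, by omega, ?_⟩
            simp only [T, if_pos hlt]
            congr 1
            omega
          · have := htm (lt_add_one (i + 1))
            refine ⟨i + 1, by omega, by omega, ?_⟩
            simp only [T, if_neg hlt]
            rw [hf _ _ (hAdj i)]
            congr 1
            omega
      refine ⟨(a i₀, (k - t i₀).toNat), ?_, ?_⟩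
      · have h1 := hts i₀
        have h2 : s (a i₀) ≤ Finset.univ.sup s := Finset.le_sup (Finset.mem_univ _)
        simp only [F, Finset.coe_product, Set.mem_prod, Finset.mem_coe, Finset.mem_univ,
          Finset.mem_range, true_and]
        omega
      · refine List.ext_get (by simp [g]) fun m hm hm' => ?_
        obtain ⟨i, h1, h2, h3⟩ := hT m
        have := hk ⟨m, hm'⟩
        simp only [g, List.get_ofFn, Fin.val_cast]
        rw [h3, ← this]
        exact (hx i _ h1 h2).symm
    calc _ ≤ (g '' (F : Set (V × ℕ))).ncard :=
          Set.ncard_le_ncard hsub (F.finite_toSet.image g)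
      _ ≤ (F : Set (V × ℕ)).ncard := Set.ncard_image_le F.finite_toSet
      _ = F.card := Set.ncard_coe_finset F
  refine squeeze_zero (fun n => div_nonneg (Real.log_natCast_nonneg _) n.cast_nonneg)
    (fun n => ?_) (tendsto_const_div_atTop_nhds_zero_nat (Real.log F.card))
  gcongr ?_ / _
  rcases Nat.eq_zero_or_pos
    {w : List V | w.length = n ∧ InLanguage (closure (SGraphCore Adj S)) w}.ncard with h0 | h0
  · rw [h0]
    simpa using Real.log_natCast_nonneg F.card
  · exact Real.log_le_log (by exact_mod_cast h0) (by exact_mod_cast hcount n)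

end Words

/-- **Zero-entropy S-graph shifts.**  Let `(G,S)` be a set-equipped graph with
`G` irreducible.  The `S`-graph shift `X(G,S)` has entropy `0` iff `G` is a
directed cycle and every set `S_v` is a singleton. -/
theorem SGraphShift_entropy_zero_iff {V : Type*} [Fintype V] [DecidableEq V]
    [TopologicalSpace V] [DiscreteTopology V]
    (Adj : V → V → Prop) (S : V → Set ℕ)
    (hLoop : ∀ v, ¬ Adj v v)
    (hNe : ∀ v, (S v).Nonempty) (hPos : ∀ v, 0 ∉ S v)
    (hIrr : ∀ u v : V, Relation.TransGen Adj u v) :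
    HasEntropy (closure (SGraphCore Adj S)) 0 ↔
      (IsDirectedCycle Adj ∧ ∀ v, ∃ s : ℕ, S v = {s}) := by
  constructor
  · intro hE
    have hout : ∀ v, ∃ u, Adj v u := fun v => by
      obtain ⟨u, hu, -⟩ := Relation.TransGen.head'_iff.1 (hIrr v v)
      exact ⟨u, hu⟩
    choose f hf using hout
    refine ⟨isDirectedCycle_of_forall_adj_iff hIrr (f := f) fun v u =>
      ⟨fun hu => ?_, fun hu => hu ▸ hf v⟩, fun v => ?_⟩
    · by_contra hne
      obtain ⟨s, hs⟩ := hNe v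
      obtain ⟨l₁, h₁, hl₁⟩ := exists_isBlockWalk hNe (hIrr u v)
      obtain ⟨l₂, h₂, hl₂⟩ := exists_isBlockWalk hNe (hIrr (f v) v)
      refine not_hasEntropy_zero_of_walks (s := s) hPos
        (l₁ := (v, s) :: l₁) (l₂ := (v, s) :: l₂) ⟨rfl, hs, _, hu, h₁⟩ ⟨rfl, hs, _, hf v, h₂⟩
        ?_ ?_ hne hE
      · simpa [List.getElem?_append_right] using h₁.blockWord_zero hPos hl₁
      · simpa [List.getElem?_append_right] using h₂.blockWord_zero hPos hl₂
    · have key : ∀ s ∈ S v, ∀ s' ∈ S v, ¬ s < s' := by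
        intro s hs s' hs' hlt
        obtain ⟨l, h, hl⟩ := exists_isBlockWalk hNe (hIrr (f v) v)
        refine not_hasEntropy_zero_of_walks (s := s) (u₁ := f v) (u₂ := v) hPos
          (l₁ := (v, s) :: l) (l₂ := (v, s') :: l) ⟨rfl, hs, _, hf v, h⟩ ⟨rfl, hs', _, hf v, h⟩
          ?_ ?_ (fun h => hLoop v (by simpa [h] using hf v)) hE
        · simpa [List.getElem?_append_right] using h.blockWord_zero hPos hl
        · rw [blockWord_cons, List.getElem?_append_left (by simpa using hlt)]
          simp [hlt]
      obtain ⟨s, hs⟩ := hNe v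
      refine ⟨s, Set.eq_singleton_iff_unique_mem.2 ⟨hs, fun s' hs' => ?_⟩⟩
      have := key s hs s' hs'
      have := key s' hs' s hs
      omega
  · rintro ⟨hc, hS⟩
    obtain ⟨f, hf⟩ := hc.exists_succ
    choose s hs using hS
    exact hasEntropy_zero_of_succ hf hs
end
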